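/- There exist a finite tile set T (whose size does not depend on m), a seed tile s ∈ T, a glue function G with all glue strengths at most 9, and two distinguished tiles t₀, t₁ ∈ T, such that for every m ≥ 1 and every binary string b = b₀b₁⋯b_{m−1}, under the temperature sequence τ^b of length 4m−1 defined by τ_{4i} = 4 for i = 0,…,m−1; τ_{4i+1} = 4 if b_i = 0 and τ_{4i+1} = 9 if b_i = 1; τ_{4i+2} = 3 for i = 0,…,m−1; and τ_{4i+3} = 7 for i = 0,…,m−2, the multiple temperature tile system ⟨T, s, G, τ^b⟩ uniquely assembles an 11 × 2m rectangle S encoding b; specifically, the tile of S in the top row at horizontal position 2i+1 (counting from 1 at the west end) is t₀ if b_i = 0 and t₁ if b_i = 1. -/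

import Mathlib

/-! ## The multiple temperature tile self-assembly model -/

/-- Glues are drawn from a countable alphabet; glue `0` is the distinguished `null` glue. -/
abbrev Glue := ℕ

/-- A tile is a quadruple of glues (north, east, south, west). -/
structure Tile where
  north : Glue
  east : Glue
  south : Glue
  west : Glue
deriving DecidableEq

/-- A configuration maps positions of `ℤ²` to a tile or to `none` (the empty tile). -/
abbrev Config := ℤ × ℤ → Option Tile

/-- Two abutting edges bond with strength `G x` when they carry the same glue `x`,
and with strength `0` otherwise. -/
def bond (G : Glue → ℕ) (x y : Glue) : ℕ := if x = y then G x else 0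

/-- Bonding strength between the edges of tile `t` at position `p` and tile `u`
at (neighboring) position `q`. -/
def edgeBond (G : Glue → ℕ) (t u : Tile) (p q : ℤ × ℤ) : ℕ :=
  if q = (p.1, p.2 + 1) then bond G t.north u.south
  else if q = (p.1 + 1, p.2) then bond G t.east u.west
  else if q = (p.1, p.2 - 1) then bond G t.south u.north
  else if q = (p.1 - 1, p.2) then bond G t.west u.east
  else 0

/-- The four L¹-neighbors of a position. -/
def neighbors (p : ℤ × ℤ) : List (ℤ × ℤ) :=
  [(p.1, p.2 + 1), (p.1 + 1, p.2), (p.1, p.2 - 1), (p.1 - 1, p.2)]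

/-- The shape of a configuration: its set of non-empty positions. -/
def shape (C : Config) : Set (ℤ × ℤ) := {p | C p ≠ none}

/-- Total bonding strength between a tile `t` placed at position `p` and the tiles of `C`
at the four neighboring positions. -/
def attachStrength (G : Glue → ℕ) (C : Config) (t : Tile) (p : ℤ × ℤ) : ℕ :=
  ((neighbors p).map (fun q =>
    match C q with
    | some u => edgeBond G t u p q
    | none => 0)).sum

/-- Bonding strength between the tiles of `C` at adjacent positions `p` and `q`. -/
def bondAt (G : Glue → ℕ) (C : Config) (p q : ℤ × ℤ) : ℕ :=
  match C p, C q with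
  | some t, some u => edgeBond G t u p q
  | _, _ => 0

/-- Total strength of the bonds from `p ∈ Q` leaving the set `Q` in configuration `C`. -/
def outStrength (G : Glue → ℕ) (C : Config) (Q : Finset (ℤ × ℤ)) (p : ℤ × ℤ) : ℕ :=
  (((neighbors p).filter (fun q => q ∉ Q)).map (fun q => bondAt G C p q)).sum

/-- Strength of the cut of (the adjacency graph of) `C` separating `Q` from its complement:
the sum over crossing edges of the bonding strengths of the corresponding abutting edges. -/
def cutStrength (G : Glue → ℕ) (C : Config) (Q : Finset (ℤ × ℤ)) : ℕ :=
  ∑ p ∈ Q, outStrength G C Q p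

/-- The initial configuration: the seed tile `s` at the origin. -/
def seedConfig (s : Tile) : Config := fun p => if p = (0, 0) then some s else none

/-- One step of assembly of the (standard) multiple temperature model at temperature `τ`:
either a tile of `T` attaches at an empty position with total bonding strength at least `τ`,
or the portion `Q` of the supertile on the non-seed side of a cut of strength `< τ`
is removed. -/
inductive Step (T : Finset Tile) (G : Glue → ℕ) (τ : ℕ) : Config → Config → Prop
  | attach (C : Config) (t : Tile) (p : ℤ × ℤ) :
      t ∈ T → C p = none → τ ≤ attachStrength G C t p →
      Step T G τ C (Function.update C p (some t))
  | detach (C : Config) (Q : Finset (ℤ × ℤ)) :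
      Q.Nonempty → ((0, 0) : ℤ × ℤ) ∉ Q → (↑Q : Set (ℤ × ℤ)) ⊆ shape C →
      cutStrength G C Q < τ →
      Step T G τ C (fun q => if q ∈ Q then none else C q)

/-- A configuration is terminal for a step relation if no step applies. -/
def Terminal (step : Config → Config → Prop) (C : Config) : Prop := ∀ D, ¬ step C D

/-- A phase finishes from `C`: there is no infinite sequence of steps starting at `C`. -/
def PhaseTerminates (step : Config → Config → Prop) (C : Config) : Prop :=
  ¬ ∃ f : ℕ → Config, f 0 = C ∧ ∀ n, step (f n) (f (n + 1))

/-- `MultiReach step τs C E`: starting from `C`, running each phase (one per temperature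
in `τs`) to a terminal configuration can produce `E`. -/
inductive MultiReach (step : ℕ → Config → Config → Prop) : List ℕ → Config → Config → Prop
  | nil {C : Config} : MultiReach step [] C C
  | cons {τ : ℕ} {τs : List ℕ} {C D E : Config} :
      Relation.ReflTransGen (step τ) C D → Terminal (step τ) D →
      MultiReach step τs D E → MultiReach step (τ :: τs) C E

/-- Every phase finishes, no matter which additions and removals are chosen. -/
inductive AllFinish (step : ℕ → Config → Config → Prop) : List ℕ → Config → Prop
  | nil {C : Config} : AllFinish step [] C
  | cons {τ : ℕ} {τs : List ℕ} {C : Config} :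
      PhaseTerminates (step τ) C →
      (∀ D, Relation.ReflTransGen (step τ) C D → Terminal (step τ) D → AllFinish step τs D) →
      AllFinish step (τ :: τs) C

/-- The tile system with seed `s` and temperature sequence `τs` uniquely produces the
configuration (supertile) `R`: all phases always finish, and every terminal configuration
produced after the last phase equals `R`. -/
def UniquelyProduces (step : ℕ → Config → Config → Prop) (s : Tile) (τs : List ℕ)
    (R : Config) : Prop :=
  AllFinish step τs (seedConfig s) ∧
  MultiReach step τs (seedConfig s) R ∧
  ∀ C, MultiReach step τs (seedConfig s) C → C = R

/-- Translation of a set of positions by `d`. -/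
def translateSet (d : ℤ × ℤ) (S : Set (ℤ × ℤ)) : Set (ℤ × ℤ) := (fun p => p + d) '' S

/-- The system uniquely assembles the shape `Υ` (up to translation). -/
def UniquelyAssembles (step : ℕ → Config → Config → Prop) (s : Tile) (τs : List ℕ)
    (Υ : Set (ℤ × ℤ)) : Prop :=
  ∃ R : Config, UniquelyProduces step s τs R ∧ ∃ d : ℤ × ℤ, shape R = translateSet d Υ

/-- The `n × n` square shape `{0,…,n−1} × {0,…,n−1}`. -/
def square (n : ℕ) : Set (ℤ × ℤ) :=
  {p : ℤ × ℤ | 0 ≤ p.1 ∧ p.1 < (n : ℤ) ∧ 0 ≤ p.2 ∧ p.2 < (n : ℤ)}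

/-- The `a × b` rectangle shape `{0,…,b−1} × {0,…,a−1}` (`b` columns, `a` rows). -/
def rect (a b : ℕ) : Set (ℤ × ℤ) :=
  {p : ℤ × ℤ | 0 ≤ p.1 ∧ p.1 < (b : ℤ) ∧ 0 ≤ p.2 ∧ p.2 < (a : ℤ)}

/-- The temperature sequence `τ^b` of length `4m − 1` encoding the binary string `b`:
`τ_{4i} = 4`; `τ_{4i+1} = 4` if `b i = 0` and `9` if `b i = 1`; `τ_{4i+2} = 3`;
`τ_{4i+3} = 7`. -/
def tempSeq1 (b : ℕ → Bool) (m : ℕ) : List ℕ :=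
  (List.range (4 * m - 1)).map fun j =>
    if j % 4 = 0 then 4
    else if j % 4 = 1 then (if b (j / 4) then 9 else 4)
    else if j % 4 = 2 then 3
    else 7



namespace MT

def Sub (C D : Config) : Prop := ∀ p t, C p = some t → D p = some t

def Stable (G : Glue → ℕ) (τ : ℕ) (C : Config) : Prop :=
  ∀ Q : Finset (ℤ × ℤ), Q.Nonempty → ((0, 0) : ℤ × ℤ) ∉ Q → (↑Q : Set (ℤ × ℤ)) ⊆ shape C →
    τ ≤ cutStrength G C Q

theorem Stable.mono {G : Glue → ℕ} {τ τ' : ℕ} {C : Config} (h : Stable G τ C) (hl : τ' ≤ τ) :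
    Stable G τ' C := fun Q a b c => hl.trans (h Q a b c)

theorem Sub.refl (C : Config) : Sub C C := fun _ _ h => h
theorem Sub.trans {C D E : Config} (h : Sub C D) (h' : Sub D E) : Sub C E :=
  fun p t x => h' p t (h p t x)

theorem Sub.ne {C D : Config} (h : Sub C D) {p} (hp : C p ≠ none) : D p ≠ none := by
  obtain ⟨t, ht⟩ := Option.ne_none_iff_exists'.1 hp
  simp [h p t ht]

theorem Sub.eq {C D : Config} (h : Sub C D) {p} (hp : C p ≠ none) : C p = D p := by
  obtain ⟨t, ht⟩ := Option.ne_none_iff_exists'.1 hp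
  simp [h p t ht, ht]

def obond (G : Glue → ℕ) (x : Glue) (f : Tile → Glue) : Option Tile → ℕ
  | some u => bond G x (f u)
  | none => 0

theorem att_eq (G : Glue → ℕ) (C : Config) (t : Tile) (p : ℤ × ℤ) :
    attachStrength G C t p =
      obond G t.north Tile.south (C (p.1, p.2 + 1)) + obond G t.east Tile.west (C (p.1 + 1, p.2)) +
      obond G t.south Tile.north (C (p.1, p.2 - 1)) +
      obond G t.west Tile.east (C (p.1 - 1, p.2)) := by
  have h1 : ¬ (p.2 = p.2 + 1) := by omega
  have h2 : ¬ (p.1 = p.1 + 1) := by omega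
  have h3 : ¬ (p.2 - 1 = p.2 + 1) := by omega
  have h4 : ¬ (p.1 - 1 = p.1) := by omega
  have h5 : ¬ (p.1 - 1 = p.1 + 1) := by omega
  have h6 : ¬ (p.2 - 1 = p.2) := by omega
  unfold attachStrength neighbors
  simp only [List.map_cons, List.map_nil, List.sum_cons, List.sum_nil]
  cases C (p.1, p.2 + 1) <;> cases C (p.1 + 1, p.2) <;> cases C (p.1, p.2 - 1) <;>
    cases C (p.1 - 1, p.2) <;>
    simp [obond, edgeBond, h1, h2, h3, h4, h5, h6, add_assoc]

theorem obond_mono (G : Glue → ℕ) (x : Glue) (f : Tile → Glue) {a b : Option Tile}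
    (h : ∀ t, a = some t → b = some t) : obond G x f a ≤ obond G x f b := by
  cases a with
  | none => simp [obond]
  | some t => rw [h t rfl]

theorem att_mono {G : Glue → ℕ} {C D : Config} (h : Sub C D) (t : Tile) (p : ℤ × ℤ) :
    attachStrength G C t p ≤ attachStrength G D t p := by
  rw [att_eq, att_eq]
  have := fun q x f => obond_mono G x f (h q)
  gcongr <;> apply this

theorem bondAt_mono {G : Glue → ℕ} {C D : Config} (h : Sub C D) (p q : ℤ × ℤ) :
    bondAt G C p q ≤ bondAt G D p q := by
  unfold bondAt
  cases hp : C p with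
  | none => simp
  | some t => cases hq : C q with
    | none => simp
    | some u => simp [h p t hp, h q u hq]

theorem bondAt_none_right {G : Glue → ℕ} {C : Config} {p q : ℤ × ℤ} (h : C q = none) :
    bondAt G C p q = 0 := by
  unfold bondAt; rw [h]; cases C p <;> rfl

theorem edgeBond_symm (G : Glue → ℕ) (t u : Tile) (p q : ℤ × ℤ) :
    edgeBond G t u p q = edgeBond G u t q p := by
  have hb : ∀ x y, bond G x y = bond G y x := by
    intro x y; unfold bond; by_cases h : x = y
    · subst h; rfl
    · simp [h, Ne.symm h]
  obtain ⟨a, b⟩ := p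
  obtain ⟨c, d⟩ := q
  unfold edgeBond
  simp only [Prod.mk.injEq]
  split_ifs <;> first | (exfalso; omega) | apply hb | rfl

theorem bondAt_symm (G : Glue → ℕ) (C : Config) (p q : ℤ × ℤ) :
    bondAt G C p q = bondAt G C q p := by
  unfold bondAt
  cases C p <;> cases C q <;> simp [edgeBond_symm G _ _ p q]

theorem bondAt_far {G : Glue → ℕ} {C : Config} {p q : ℤ × ℤ} (h : q ∉ neighbors p) :
    bondAt G C p q = 0 := by
  unfold bondAt
  simp only [neighbors, List.mem_cons, List.not_mem_nil, or_false, not_or] at h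
  cases C p <;> cases C q <;> simp [edgeBond, h]

theorem nodup_neighbors (p : ℤ × ℤ) : (neighbors p).Nodup := by
  simp [neighbors, Prod.ext_iff]; omega

theorem out_eq_sum (G : Glue → ℕ) (C : Config) (Q : Finset (ℤ × ℤ)) (p : ℤ × ℤ) :
    outStrength G C Q p = ∑ q ∈ (neighbors p).toFinset with q ∉ Q, bondAt G C p q := by
  unfold outStrength
  have h : ({q ∈ (neighbors p).toFinset | q ∉ Q} : Finset (ℤ × ℤ)) =
      ((neighbors p).filter (fun q => q ∉ Q)).toFinset := by
    ext q; simp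
  rw [h, List.sum_toFinset]
  exact (nodup_neighbors p).filter _

theorem out_ge (G : Glue → ℕ) (C : Config) (Q A : Finset (ℤ × ℤ)) (p : ℤ × ℤ)
    (hA : Disjoint A Q) : ∑ q ∈ A, bondAt G C p q ≤ outStrength G C Q p := by
  rw [out_eq_sum]
  rw [← Finset.sum_filter_add_sum_filter_not A (fun q => q ∈ neighbors p)]
  rw [Finset.sum_eq_zero (s := {x ∈ A | x ∉ neighbors p}), add_zero]
  · apply Finset.sum_le_sum_of_subset
    intro q hq
    simp only [Finset.mem_filter, List.mem_toFinset] at hq ⊢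
    exact ⟨hq.2, Finset.disjoint_left.1 hA hq.1⟩
  · intro q hq
    exact bondAt_far (Finset.mem_filter.1 hq).2

theorem out_mono {G : Glue → ℕ} {C D : Config} (h : Sub C D) (Q : Finset (ℤ × ℤ)) (p : ℤ × ℤ) :
    outStrength G C Q p ≤ outStrength G D Q p := by
  rw [out_eq_sum, out_eq_sum]
  exact Finset.sum_le_sum fun q _ => bondAt_mono h p q

theorem cut_mono {G : Glue → ℕ} {C D : Config} (h : Sub C D) (Q : Finset (ℤ × ℤ)) :
    cutStrength G C Q ≤ cutStrength G D Q :=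
  Finset.sum_le_sum fun p _ => out_mono h Q p

theorem sub_update {C : Config} {p : ℤ × ℤ} (hp : C p = none) (t : Tile) :
    Sub C (Function.update C p (some t)) := by
  intro q u hq
  have : q ≠ p := by rintro rfl; simp [hp] at hq
  simp [this, hq]

theorem stable_update {G : Glue → ℕ} {τ : ℕ} {C : Config} {p : ℤ × ℤ} {t : Tile}
    (hs : Stable G τ C) (hp : C p = none) (ht : τ ≤ attachStrength G C t p) :
    Stable G τ (Function.update C p (some t)) := by
  intro Q hQ h0 hsub
  have hS := sub_update hp t
  set C' := Function.update C p (some t) with hC'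
  by_cases hpQ : p ∈ Q
  · by_cases hQ' : (Q.erase p).Nonempty
    · have h1 : (↑(Q.erase p) : Set (ℤ × ℤ)) ⊆ shape C := by
        intro q hq
        have hq' := Finset.mem_erase.1 (Finset.mem_coe.1 hq)
        have := hsub (Finset.mem_coe.2 hq'.2)
        simpa [shape, hC', hq'.1] using this
      refine (hs _ hQ' (fun h => h0 (Finset.mem_of_mem_erase h)) h1).trans ?_
      unfold cutStrength
      refine le_trans ?_ (Finset.sum_le_sum_of_subset (Finset.erase_subset p Q))
      apply Finset.sum_le_sum
      intro q hq
      rw [out_eq_sum, out_eq_sum]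
      calc ∑ r ∈ (neighbors q).toFinset with r ∉ Q.erase p, bondAt G C q r
          ≤ ∑ r ∈ (neighbors q).toFinset with r ∉ Q.erase p,
              (if r ∉ Q then bondAt G C' q r else 0) := by
            apply Finset.sum_le_sum
            intro r hr
            by_cases hr' : r ∈ Q
            · have : r = p := by
                by_contra hne
                exact (Finset.mem_filter.1 hr).2 (Finset.mem_erase.2 ⟨hne, hr'⟩)
              subst this
              simp [bondAt_none_right hp]
            · simp only [hr', not_false_eq_true, if_true]
              exact bondAt_mono hS q r
        _ ≤ _ := by
            rw [← Finset.sum_filter, Finset.filter_filter]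
            apply Finset.sum_le_sum_of_subset
            intro r hr
            simp only [Finset.mem_filter] at hr ⊢
            exact ⟨hr.1, hr.2.2⟩
    · have hQp : Q = {p} := by
        rw [Finset.not_nonempty_iff_eq_empty, Finset.erase_eq_empty_iff] at hQ'
        rcases hQ' with h | h
        · simp [h] at hpQ
        · exact h
      subst hQp
      refine ht.trans ?_
      unfold cutStrength
      rw [Finset.sum_singleton]
      unfold outStrength attachStrength
      have : (neighbors p).filter (fun q => q ∉ ({p} : Finset (ℤ × ℤ))) = neighbors p := by
        apply List.filter_eq_self.2
        intro q hq
        simp only [Finset.mem_singleton, decide_eq_true_eq]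
        rintro rfl
        simp [neighbors, Prod.ext_iff] at hq
        omega
      rw [this]
      apply List.sum_le_sum
      intro q hq
      have hqp : q ≠ p := by
        rintro rfl
        simp [neighbors, Prod.ext_iff] at hq
        omega
      simp [bondAt, hC', hqp]
      cases C q <;> simp
  · have h1 : (↑Q : Set (ℤ × ℤ)) ⊆ shape C := by
      intro q hq
      have hne : q ≠ p := by rintro rfl; exact hpQ hq
      have := hsub hq
      simpa [shape, hC', hne] using this
    exact (hs Q hQ h0 h1).trans (cut_mono hS Q)

def PhaseTo (step : Config → Config → Prop) (C D : Config) : Prop :=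
  PhaseTerminates step C ∧ Relation.ReflTransGen step C D ∧ Terminal step D ∧
    ∀ E, Relation.ReflTransGen step C E → Terminal step E → E = D

theorem phaseTo_inv {step : Config → Config → Prop} (Inv : Config → Prop) (μ : Config → ℕ)
    {C D : Config} (hC : Inv C)
    (hstep : ∀ E E', Inv E → step E E' → Inv E' ∧ μ E' < μ E)
    (hprog : ∀ E, Inv E → E = D ∨ ∃ E', step E E') (hD : μ D = 0) : PhaseTo step C D := by
  have hreach : ∀ E, Relation.ReflTransGen step C E → Inv E := by
    intro E h
    induction h with
    | refl => exact hC
    | tail _ h ih => exact (hstep _ _ ih h).1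
  have hgo : ∀ n E, Inv E → μ E ≤ n → Relation.ReflTransGen step E D := by
    intro n
    induction n with
    | zero =>
      intro E hE hn
      rcases hprog E hE with rfl | ⟨E', h⟩
      · exact .refl
      · have := (hstep _ _ hE h).2; omega
    | succ n ih =>
      intro E hE hn
      rcases hprog E hE with rfl | ⟨E', h⟩
      · exact .refl
      · have := hstep _ _ hE h
        exact .head h (ih E' this.1 (by omega))
  have hCD := hgo _ C hC le_rfl
  refine ⟨?_, hCD, ?_, ?_⟩
  · rintro ⟨f, h0, hf⟩
    have hI : ∀ n, Inv (f n) ∧ μ (f n) + n ≤ μ C := by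
      intro n
      induction n with
      | zero => rw [h0]; exact ⟨hC, by omega⟩
      | succ n ih =>
        have := hstep _ _ ih.1 (hf n)
        exact ⟨this.1, by omega⟩
    have := (hI (μ C + 1)).2
    omega
  · intro E h
    have := (hstep _ _ (hreach _ hCD) h).2
    omega
  · intro E hE hT
    rcases hprog E (hreach E hE) with h | ⟨E', h⟩
    · exact h
    · exact absurd h (hT E')

theorem phaseTo_head {step : Config → Config → Prop} {C C0 D : Config}
    (h : ∀ E, step C E ↔ E = C0) (hD : PhaseTo step C0 D) : PhaseTo step C D := by
  obtain ⟨h1, h2, h3, h4⟩ := hD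
  refine ⟨?_, .head ((h C0).2 rfl) h2, h3, ?_⟩
  · rintro ⟨f, h0, hf⟩
    refine h1 ⟨fun n => f (n + 1), ?_, fun n => hf (n + 1)⟩
    have := hf 0
    rw [h0] at this
    exact (h _).1 this
  · intro E hE hT
    rcases Relation.ReflTransGen.cases_head hE with rfl | ⟨c, hc, hcE⟩
    · exact absurd ((h C0).2 rfl) (hT _)
    · rw [(h c).1 hc] at hcE
      exact h4 E hcE hT

inductive Chain (step : ℕ → Config → Config → Prop) : List ℕ → Config → Config → Prop
  | nil {C : Config} : Chain step [] C C
  | cons {τ : ℕ} {τs : List ℕ} {C D E : Config} :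
      PhaseTo (step τ) C D → Chain step τs D E → Chain step (τ :: τs) C E

theorem Chain.append {step : ℕ → Config → Config → Prop} {l l' : List ℕ} {C D E : Config}
    (h : Chain step l C D) (h' : Chain step l' D E) : Chain step (l ++ l') C E := by
  induction h with
  | nil => exact h'
  | cons a _ ih => exact .cons a (ih h')

theorem Chain.result {step : ℕ → Config → Config → Prop} {l : List ℕ} {C D : Config}
    (h : Chain step l C D) : AllFinish step l C ∧ MultiReach step l C D ∧
      ∀ E, MultiReach step l C E → E = D := by
  induction h with
  | nil => exact ⟨.nil, .nil, fun E h => by cases h; rfl⟩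
  | cons a _ ih =>
    obtain ⟨a1, a2, a3, a4⟩ := a
    refine ⟨.cons a1 fun F hF hT => ?_, .cons a2 a3 ih.2.1, fun E hE => ?_⟩
    · rw [a4 F hF hT]; exact ih.1
    · cases hE with
      | cons b1 b2 b3 =>
        rw [a4 _ b1 b2] at b3
        exact ih.2.2 E b3

/-- Staged growth conditions. -/
def GrowOK (T : Finset Tile) (G : Glue → ℕ) (τ : ℕ) (C : Config) :
    List (ℤ × ℤ) → Config → List ((ℤ × ℤ) × Config) → Prop
  | zs, R, [] => ∀ t ∈ T, ∀ p, C p = none → τ ≤ attachStrength G R t p → p ∈ zs ∨ R p = some t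
  | zs, R, (z, R') :: rest =>
      (∀ t ∈ T, ∀ p, C p = none → τ ≤ attachStrength G R t p →
        p ∈ zs ∨ R p = some t ∨ (p = z ∧ R' p = some t)) ∧
      Sub R R' ∧ GrowOK T G τ C (z :: zs) R' rest

def lastR : Config → List ((ℤ × ℤ) × Config) → Config
  | R, [] => R
  | _, (_, R') :: rest => lastR R' rest

def InvL (E : Config) : Config → List ((ℤ × ℤ) × Config) → Prop
  | R, [] => Sub E R
  | R, (z, R') :: rest => (E z = none → Sub E R) ∧ (E z ≠ none → InvL E R' rest)

theorem GrowOK.sub {T : Finset Tile} {G : Glue → ℕ} {τ : ℕ} {C : Config} :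
    ∀ (l : List ((ℤ × ℤ) × Config)) (zs : List (ℤ × ℤ)) (R : Config),
      GrowOK T G τ C zs R l → Sub R (lastR R l)
  | [], _, R, _ => Sub.refl R
  | (_, R') :: rest, _, _, h => h.2.1.trans (GrowOK.sub rest _ R' h.2.2)

theorem GrowOK.inv {T : Finset Tile} {G : Glue → ℕ} {τ : ℕ} {C E : Config} :
    ∀ (l : List ((ℤ × ℤ) × Config)) (zs : List (ℤ × ℤ)) (R : Config),
      GrowOK T G τ C zs R l → Sub E R → InvL E R l
  | [], _, _, _, hE => hE
  | (_, R') :: rest, _, _, h, hE => ⟨fun _ => hE, fun _ =>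
      GrowOK.inv rest _ R' h.2.2 (hE.trans h.2.1)⟩

theorem GrowOK.le {T : Finset Tile} {G : Glue → ℕ} {τ : ℕ} {C E : Config} :
    ∀ (l : List ((ℤ × ℤ) × Config)) (zs : List (ℤ × ℤ)) (R : Config),
      GrowOK T G τ C zs R l → InvL E R l → Sub E (lastR R l)
  | [], _, _, _, hE => hE
  | (z, R') :: rest, zs, R, h, hE => by
      by_cases hz : E z = none
      · exact (hE.1 hz).trans (GrowOK.sub _ _ _ h)
      · exact GrowOK.le rest _ R' h.2.2 (hE.2 hz)

theorem sub_up {E F : Config} {p : ℤ × ℤ} {t : Tile} (hF : Sub E F) (hFp : F p = some t) :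
    Sub (Function.update E p (some t)) F := by
  intro q u hq
  by_cases hqp : q = p
  · subst hqp
    simp only [Function.update_self] at hq
    rw [hFp, hq]
  · simp only [Function.update_of_ne hqp] at hq
    exact hF q u hq

theorem GrowOK.step {T : Finset Tile} {G : Glue → ℕ} {τ : ℕ} {C E : Config} {t : Tile}
    {p : ℤ × ℤ} (ht : t ∈ T) (hE : E p = none) (hC : C p = none)
    (ha : τ ≤ attachStrength G E t p) :
    ∀ (l : List ((ℤ × ℤ) × Config)) (zs : List (ℤ × ℤ)) (R : Config),
      GrowOK T G τ C zs R l → (∀ z ∈ zs, E z ≠ none) → InvL E R l →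
      InvL (Function.update E p (some t)) R l
  | [], zs, R, h, hzs, hI => by
      rcases h t ht p hC (ha.trans (att_mono hI t p)) with h' | h'
      · exact absurd hE (hzs p h')
      · exact sub_up hI h'
  | (z, R') :: rest, zs, R, h, hzs, hI => by
      by_cases hz : E z = none
      · have hER := hI.1 hz
        rcases h.1 t ht p hC (ha.trans (att_mono hER t p)) with h' | h' | ⟨rfl, h'⟩
        · exact absurd hE (hzs p h')
        · exact GrowOK.inv _ _ _ h (sub_up hER h')
        · refine ⟨fun hh => by simp at hh, fun _ => ?_⟩
          exact GrowOK.inv _ _ _ h.2.2 (sub_up (hER.trans h.2.1) h')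
      · have hz' : Function.update E p (some t) z ≠ none := (sub_update hE t).ne hz
        refine ⟨fun hh => absurd hh hz', fun _ => ?_⟩
        refine GrowOK.step ht hE hC ha rest (z :: zs) R' h.2.2 ?_ (hI.2 hz)
        intro y hy
        rcases List.mem_cons.1 hy with rfl | hy
        · exact hz
        · exact hzs y hy

/-- Staged growth. -/
theorem growth {T : Finset Tile} {G : Glue → ℕ} {τ : ℕ} {C R D : Config}
    {l : List ((ℤ × ℤ) × Config)} {N : Finset (ℤ × ℤ)}
    (hCR : Sub C R) (hlast : lastR R l = D) (hS : Stable G τ C)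
    (hG : GrowOK T G τ C [] R l)
    (hN : ∀ p, D p ≠ none → C p = none → p ∈ N) (hN' : ∀ p ∈ N, D p ≠ none)
    (hL : ∀ E, Sub C E → Sub E D → (∀ p ∈ N, E p ≠ none) ∨
      ∃ p t, t ∈ T ∧ E p = none ∧ τ ≤ attachStrength G E t p) :
    PhaseTo (Step T G τ) C D ∧ Stable G τ D := by
  classical
  have hstep : ∀ E E', (Sub C E ∧ Stable G τ E ∧ InvL E R l) → Step T G τ E E' →
      (Sub C E' ∧ Stable G τ E' ∧ InvL E' R l) ∧
      (N.filter (fun p => E' p = none)).card < (N.filter (fun p => E p = none)).card := by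
    rintro E E' ⟨i1, i3, i4⟩ hst
    cases hst with
    | attach t p ht hp hatt =>
      have hCp : C p = none := by
        by_contra h; exact (i1.ne h) hp
      have key := GrowOK.step ht hp hCp hatt l [] R hG (by simp) i4
      have hDp : D p = some t := by
        have := GrowOK.le l [] R hG key p t (by simp)
        rwa [hlast] at this
      refine ⟨⟨i1.trans (sub_update hp t), stable_update i3 hp hatt, key⟩, ?_⟩
      apply Finset.card_lt_card
      rw [Finset.ssubset_iff_of_subset]
      · refine ⟨p, Finset.mem_filter.2 ⟨hN p (by simp [hDp]) hCp, hp⟩, ?_⟩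
        simp
      · intro q hq
        rw [Finset.mem_filter] at hq ⊢
        refine ⟨hq.1, ?_⟩
        by_contra h
        exact (sub_update hp t).ne h hq.2
    | detach Q hQ h0 hsub hcut =>
      have := i3 Q hQ h0 hsub
      omega
  have hC0 : Sub C C ∧ Stable G τ C ∧ InvL C R l :=
    ⟨Sub.refl C, hS, GrowOK.inv l [] R hG hCR⟩
  have hP : PhaseTo (Step T G τ) C D := by
    refine phaseTo_inv (fun E => Sub C E ∧ Stable G τ E ∧ InvL E R l)
      (fun E => (N.filter (fun p => E p = none)).card) hC0 hstep ?_ ?_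
    · rintro E ⟨i1, i3, i4⟩
      have i2 : Sub E D := hlast ▸ GrowOK.le l [] R hG i4
      rcases hL E i1 i2 with h | ⟨p, t, ht, hp, hatt⟩
      · left
        funext p
        by_cases hp : E p = none
        · rw [hp]
          by_contra hne
          have hD : D p ≠ none := fun h => hne h.symm
          by_cases hCp : C p = none
          · exact h p (hN p hD hCp) hp
          · exact (i1.ne hCp) hp
        · exact i2.eq hp
      · right
        exact ⟨_, .attach E t p ht hp hatt⟩
    · rw [Finset.card_eq_zero, Finset.filter_eq_empty_iff]
      intro p hp h
      exact hN' p hp h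
  refine ⟨hP, ?_⟩
  have : ∀ E, Relation.ReflTransGen (Step T G τ) C E →
      Sub C E ∧ Stable G τ E ∧ InvL E R l := by
    intro E h
    induction h with
    | refl => exact hC0
    | tail _ h ih => exact (hstep _ _ ih h).1
  exact (this D hP.2.1).2.1

theorem phaseTo_terminal {step : Config → Config → Prop} {D : Config} (h : Terminal step D) :
    PhaseTo step D D := by
  refine ⟨?_, .refl, h, ?_⟩
  · rintro ⟨f, h0, hf⟩
    have := hf 0
    rw [h0] at this
    exact h _ this
  · intro E hE _
    rcases Relation.ReflTransGen.cases_head hE with rfl | ⟨c, hc, _⟩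
    · rfl
    · exact absurd hc (h c)

end MT


namespace MT

/-- glue strengths, glue `i` has strength the `i`-th entry -/
def gl : List ℕ :=
  [0, 9, 4, 9, 4, 2, 9, 9, 9, 9, 3, 9, 3, 9, 3, 9, 9, 9, 9, 9, 9, 9, 9, 2, 2, 2, 2, 2, 2, 3, 9, 3, 9, 9, 9, 2, 2, 2, 2, 9, 9, 9, 9, 9, 2, 3, 9, 3, 9, 9, 9, 9, 9, 9, 3, 9]

def G (x : Glue) : ℕ := gl.getD x 0

def q_t0 : Tile := ⟨0, 1, 2, 0⟩
def q_A2 : Tile := ⟨0, 0, 3, 1⟩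
def q_A : Tile := ⟨3, 5, 4, 0⟩
def q_t1 : Tile := ⟨0, 9, 0, 0⟩
def q_B2 : Tile := ⟨0, 0, 8, 9⟩
def q_B : Tile := ⟨8, 5, 0, 6⟩
def q_U9 : Tile := ⟨2, 6, 7, 5⟩
def q_U8 : Tile := ⟨7, 10, 11, 0⟩
def q_U7 : Tile := ⟨11, 12, 13, 0⟩
def q_U6 : Tile := ⟨13, 14, 15, 0⟩
def q_K8 : Tile := ⟨4, 0, 16, 10⟩
def q_K7 : Tile := ⟨16, 0, 17, 12⟩
def q_seed : Tile := ⟨17, 0, 29, 14⟩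
def q_a5 : Tile := ⟨15, 23, 18, 0⟩
def q_a4 : Tile := ⟨18, 24, 19, 0⟩
def q_a3 : Tile := ⟨19, 25, 20, 0⟩
def q_a2 : Tile := ⟨20, 26, 21, 0⟩
def q_a1 : Tile := ⟨21, 27, 22, 0⟩
def q_a0 : Tile := ⟨22, 28, 0, 0⟩
def q_Za : Tile := ⟨29, 0, 30, 0⟩
def q_Zb : Tile := ⟨30, 0, 31, 0⟩
def q_F3 : Tile := ⟨31, 35, 32, 25⟩
def q_F2 : Tile := ⟨32, 36, 33, 26⟩
def q_F1 : Tile := ⟨33, 37, 34, 27⟩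
def q_F0 : Tile := ⟨34, 38, 0, 28⟩
def q_Ya : Tile := ⟨39, 40, 31, 24⟩
def q_Yb : Tile := ⟨0, 0, 39, 23⟩
def q_K6 : Tile := ⟨17, 0, 41, 14⟩
def q_K5 : Tile := ⟨41, 0, 45, 42⟩
def q_L5 : Tile := ⟨0, 42, 43, 0⟩
def q_L4 : Tile := ⟨43, 44, 0, 40⟩
def q_Zc : Tile := ⟨45, 0, 46, 0⟩
def q_Zd : Tile := ⟨46, 0, 47, 0⟩
def q_R2 : Tile := ⟨47, 36, 49, 48⟩
def q_R1 : Tile := ⟨49, 37, 50, 0⟩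
def q_R0 : Tile := ⟨50, 38, 0, 0⟩
def q_L3 : Tile := ⟨0, 54, 51, 35⟩
def q_L2 : Tile := ⟨51, 48, 52, 36⟩
def q_L1 : Tile := ⟨52, 0, 53, 37⟩
def q_L0 : Tile := ⟨53, 0, 0, 38⟩
def q_Yc : Tile := ⟨55, 35, 47, 54⟩
def q_Yd : Tile := ⟨0, 40, 55, 44⟩

def tl : List Tile :=
  [q_t0, q_A2, q_A, q_t1, q_B2, q_B, q_U9, q_U8, q_U7, q_U6, q_K8, q_K7, q_seed, q_a5,
   q_a4, q_a3, q_a2, q_a1, q_a0, q_Za, q_Zb, q_F3, q_F2, q_F1, q_F0, q_Ya, q_Yb, q_K6,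
   q_K5, q_L5, q_L4, q_Zc, q_Zd, q_R2, q_R1, q_R0, q_L3, q_L2, q_L1, q_L0, q_Yc, q_Yd]

/-- Tile set. -/
def T : Finset Tile := tl.toFinset

/-- State of a block of two columns: `l`ive, `f`irst block, base `k` (3 is full), trunk `u`,
top group `g`, `z` (0 none, 1 first trigger tile, 2 both, 3 final tiles, 4 partial), filler `w`. -/
structure St where
  l : Bool
  f : Bool
  k : ℕ
  u : Bool
  g : ℕ
  z : ℕ
  w : Bool

def oi (b : Bool) (t : Tile) : Option Tile := if b then some t else none

def o3 (n : ℕ) (a b c : Option Tile) : Option Tile :=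
  match n with
  | 0 => none
  | 1 => a
  | 2 => b
  | 3 => c
  | _ => none

def col0 (s : St) : List (Option Tile) :=
  (if s.f then [oi s.u q_a0, oi s.u q_a1, oi s.u q_a2, oi s.u q_a3, oi s.u q_a4, oi s.u q_a5]
   else [oi s.w q_L0, oi s.w q_L1, oi s.w q_L2, oi s.w q_L3, oi (1 ≤ s.k) q_L4, oi (2 ≤ s.k) q_L5]) ++
  [oi s.u q_U6, oi s.u q_U7, oi s.u q_U8, oi s.u q_U9, o3 s.g (some q_t0) (some q_t1) none]

def col1 (s : St) : List (Option Tile) :=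
  (if s.f then
    [oi s.w q_F0, oi s.w q_F1, oi s.w q_F2, oi s.w q_F3,
     o3 s.z none (some q_Zb) (some q_Ya), o3 s.z (some q_Za) (some q_Za) (some q_Yb),
     some q_seed]
   else
    [oi s.w q_R0, oi s.w q_R1, oi s.w q_R2,
     (if s.z = 4 then some q_Yc else o3 s.z none (some q_Zd) (some q_Yc)), o3 s.z (some q_Zc) (some q_Zc) (some q_Yd),
     oi (2 ≤ s.k) q_K5, oi (3 ≤ s.k) q_K6]) ++
  [oi (3 ≤ s.k) q_K7, oi (3 ≤ s.k) q_K8, o3 s.g (some q_A) (some q_B) none,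
   o3 s.g (some q_A2) (some q_B2) none]

def nth (l : List (Option Tile)) (y : ℤ) : Option Tile :=
  match y with
  | Int.ofNat n => l.getD n none
  | Int.negSucc _ => none

/-- tile of a block at column `c`, row `y` -/
def cell (s : St) (c y : ℤ) : Option Tile :=
  if s.l then (if c = 0 then nth (col0 s) y else nth (col1 s) y) else none

def conf (st : ℤ → St) : Config := fun p => cell (st ((p.1 + 1) / 2)) ((p.1 + 1) % 2) (p.2 + 6)

def sE : St := ⟨false, false, 0, false, 0, 0, false⟩
/-- seed only -/
def sI : St := ⟨true, true, 0, false, 0, 0, false⟩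
def sB (f : Bool) : St := ⟨true, f, 3, false, 0, 0, false⟩
def sG (f : Bool) : St := ⟨true, f, 3, true, 0, 0, false⟩
def gb (b : Bool) : ℕ := if b then 2 else 1
def sQ (f b : Bool) : St := ⟨true, f, 3, true, gb b, 0, false⟩
def sZ (f b : Bool) : St := ⟨true, f, 3, true, gb b, 1, false⟩
def sR (f b : Bool) : St := ⟨true, f, 3, true, gb b, 2, true⟩
def sS (f b : Bool) : St := ⟨true, f, 3, true, gb b, 0, true⟩
def sD (f b : Bool) : St := ⟨true, f, 3, true, gb b, 3, true⟩

/-- partial base -/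
def sK (n : ℕ) : St := ⟨true, false, n, false, 0, 0, false⟩
/-- partial final tiles -/
def sH (f b : Bool) : St := ⟨true, f, 3, true, gb b, 4, true⟩

def tri (a b c : St) (k : ℤ) : St :=
  if k = 0 then b else if k = -1 then a else if k = 1 then c else sE

/-! ### Boolean checks -/

def og (f : Tile → Glue) : Option Tile → Glue
  | some u => f u
  | none => 0

/-- potential of a site -/
def sc (t : Tile) (n e s w : Glue) : ℕ :=
  bond G t.north n + bond G t.east e + bond G t.south s + bond G t.west w

def siteOK (τ : ℕ) (good : Tile → Bool) (n e s w : Glue) : Bool :=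
  decide (G n + G e + G s + G w < τ) ||
    tl.all (fun t => decide (sc t n e s w < τ) || good t)

def siteC (τ : ℕ) (good : Tile → Bool) (C : Config) (p : ℤ × ℤ) : Bool :=
  siteOK τ good (og Tile.south (C (p.1, p.2 + 1))) (og Tile.west (C (p.1 + 1, p.2)))
    (og Tile.north (C (p.1, p.2 - 1))) (og Tile.east (C (p.1 - 1, p.2)))

def cells : List (ℤ × ℤ) :=
  [(-1,-7),(-1,-6),(-1,-5),(-1,-4),(-1,-3),(-1,-2),(-1,-1),(-1,0),(-1,1),(-1,2),(-1,3),(-1,4),(-1,5),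
   (0,-7),(0,-6),(0,-5),(0,-4),(0,-3),(0,-2),(0,-1),(0,0),(0,1),(0,2),(0,3),(0,4),(0,5)]

/-- cells of the block where no wrong tile attaches -/
def noAtt (τ : ℕ) (gd : St) (a b c : St) (good : ℤ × ℤ → Tile → Bool) : Bool :=
  cells.all fun p => (cell gd (p.1 + 1) (p.2 + 6)).isSome || siteC τ (good p) (conf (tri a b c)) p

def fitE (b : St) (p : ℤ × ℤ) (t : Tile) : Bool := decide (cell b (p.1 + 1) (p.2 + 6) = some t)

/-- growth along a list of cells -/
def ov (C D : Config) (e : List (ℤ × ℤ)) : Config := fun q => if q ∈ e then D q else C q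

def gchk (τ : ℕ) (C D : Config) : List (ℤ × ℤ) → List (ℤ × ℤ) → Bool
  | _, [] => true
  | e, p :: ps => (match D p with
      | some t => decide (t ∈ tl) && decide (τ ≤ attachStrength G (ov C D e) t p)
      | none => false) && gchk τ C D (p :: e) ps

def dl (C : Config) (p : ℤ × ℤ) (v : Bool) : List ((ℤ × ℤ) × Bool) → ℕ
  | [] => 0
  | (q, u) :: r => (if u = v then 0 else bondAt G C p q) + dl C p v r

def bt (C : Config) (τ : ℕ) (ok : List ((ℤ × ℤ) × Bool) → Bool) :
    List (ℤ × ℤ) → List ((ℤ × ℤ) × Bool) → ℕ → Bool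
  | [], as, acc => decide (τ ≤ acc) || ok as
  | p :: ps, as, acc => decide (τ ≤ acc) ||
      (bt C τ ok ps ((p, false) :: as) (acc + dl C p false as) &&
       bt C τ ok ps ((p, true) :: as) (acc + dl C p true as))


def prevs (f : Bool) : List St :=
  if f then [sE] else [sD true false, sD true true, sD false false, sD false true]

def bs : List Bool := [false, true]

def cFar (τ : ℕ) : Bool :=
  bs.all fun f => bs.all fun b => bs.all fun c => (prevs f).all fun a =>
    noAtt τ (sD f b) a (sD f b) (sD false c) (fitE (sD f b))

def cEnd (τ : ℕ) : Bool := noAtt τ sE sE sE sE (fitE sE) &&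
  bs.all fun b => noAtt τ sE sE sE (sD true b) (fitE sE)

/-- A growth stage: state of the previous block, of the current block, and the cell that
ends the stage. -/
structure Sg where
  pv : Bool → Bool → St
  X : St
  z : ℤ × ℤ

/-- allowed tiles at a window cell `p` (window cell `p` is the cell `p'` of a block) -/
def good (zs : List (ℤ × ℤ)) (z : ℤ × ℤ) (X X' : St) (d : ℤ) (p : ℤ × ℤ) (t : Tile) : Bool :=
  decide ((p.1 - d, p.2) ∈ zs) || fitE X p t || (decide ((p.1 - d, p.2) = z) && fitE X' p t)

/-- one stage, with next stage `n` -/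
def stg (τ : ℕ) (f : Bool) (gd : St) (gp : Bool → Bool → St) (zs : List (ℤ × ℤ))
    (s n : Sg) : Bool :=
  noAtt τ sE s.X sE sE (fitE sE) &&
  (if f then noAtt τ sE sE sE s.X (fitE sE) && noAtt τ gd sE s.X sE (good zs s.z s.X n.X 0)
   else
    (bs.all fun b =>
      noAtt τ sE sE sE (s.pv true b) (fitE sE) &&
      (bs.all fun f' => noAtt τ gd (s.pv f' b) s.X sE (good zs s.z s.X n.X 0) &&
        (prevs f').all fun a =>
          noAtt τ (gp f' b) a (s.pv f' b) s.X (good zs s.z (s.pv f' b) (n.pv f' b) 2) &&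
          bs.all fun c => noAtt τ (sD f' b) a (sD f' b) (s.pv false c) (fitE (sD f' b)))))

def leB (s s' : St) : Bool :=
  cells.all fun p => (cell s (p.1 + 1) (p.2 + 6)).isNone ||
    decide (cell s (p.1 + 1) (p.2 + 6) = cell s' (p.1 + 1) (p.2 + 6))

def leP (s s' : Bool → Bool → St) : Bool := bs.all fun f => bs.all fun b => leB (s f b) (s' f b)

def stgs (τ : ℕ) (f : Bool) (gd : St) (gp : Bool → Bool → St) :
    List (ℤ × ℤ) → Sg → List Sg → Bool
  | zs, s, [] => stg τ f gd gp zs s s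
  | zs, s, s' :: r => stg τ f gd gp zs s s' && leB s.X s'.X && leP s.pv s'.pv &&
      stgs τ f gd gp (s.z :: zs) s' r

def lastS : Sg → List Sg → Sg
  | s, [] => s
  | _, s' :: r => lastS s' r

def newIn (C D : St) (d : ℤ) (L : List (ℤ × ℤ)) : Bool :=
  cells.all fun p => (cell D (p.1 + 1) (p.2 + 6)).isNone ||
    (cell C (p.1 + 1) (p.2 + 6)).isSome || decide ((p.1 - d, p.2) ∈ L)

def gro (τ : ℕ) (f : Bool) (gd : St) (gp : Bool → Bool → St) (L : Bool → List (ℤ × ℤ))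
    (e : Sg) : Bool :=
  if f then newIn gd e.X 0 (L true) &&
      gchk τ (conf (tri sE gd sE)) (conf (tri sE e.X sE)) [] (L true)
  else bs.all fun f' => bs.all fun b => newIn gd e.X 0 (L f') &&
      newIn (gp f' b) (e.pv f' b) 2 (L f') &&
      gchk τ (conf (tri (gp f' b) gd sE)) (conf (tri (e.pv f' b) e.X sE)) [] (L f')

/-- everything to be checked for a growth phase -/
def phaseB (τ : ℕ) (f : Bool) (gd : St) (gp : Bool → Bool → St) (s : Sg) (r : List Sg)
    (L : Bool → List (ℤ × ℤ)) : Bool :=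
  leB gd s.X && leP gp s.pv && stgs τ f gd gp [] s r && gro τ f gd gp L (lastS s r)

def gd1 (f : Bool) : St := if f then sI else sE
def sP (f : Bool) : St := sQ f false

def s1 (f : Bool) : Sg := if f then ⟨sD, sB true, (0, 3)⟩ else ⟨sH, sE, (-2, -2)⟩
def r1 (f : Bool) : List Sg := if f then [⟨sD, sP true, 0⟩] else
  [⟨sD, sK 1, (-1, -1)⟩, ⟨sD, sK 2, (0, 0)⟩, ⟨sD, sB false, (0, 3)⟩, ⟨sD, sP false, 0⟩]
def topL : List (ℤ × ℤ) := [(0,1),(0,2),(0,3),(0,4),(-1,4),(-1,3),(-1,2),(-1,1),(-1,0)]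
def L1 (f : Bool) (f' : Bool) : List (ℤ × ℤ) :=
  if f then topL ++ [(-1,-1),(-1,-2),(-1,-3),(-1,-4),(-1,-5),(-1,-6)]
  else (if f' then [(-2,-2),(-2,-1)] else [(-2,-3),(-2,-2)]) ++
    [(-1,-2),(-1,-1),(0,-1),(0,0)] ++ topL
def L2 (_ : Bool) : List (ℤ × ℤ) := [(0,3),(0,4),(-1,4)]
def L3 (f : Bool) (_ : Bool) : List (ℤ × ℤ) :=
  if f then [(0,-1),(0,-2),(0,-3),(0,-4),(0,-5),(0,-6)]
  else [(0,-2),(0,-3),(0,-4),(0,-5),(0,-6),(-1,-4),(-1,-5),(-1,-6),(-1,-3)]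
def z3 (f : Bool) : ℤ × ℤ := if f then (0, -2) else (0, -3)

def ct : List ℕ := [3, 4, 7, 9]
def chkA : Bool := ct.all cFar && ct.all cEnd

def chk1 : Bool := bs.all fun f => phaseB 4 f (gd1 f) sS (s1 f) (r1 f) (L1 f)
def idB (τ : ℕ) (f : Bool) (X : St) : Bool := phaseB τ f X sD ⟨sD, X, 0⟩ [] fun _ => []
def chk2 : Bool := bs.all fun f => idB 9 f (sP f) &&
  phaseB 9 f (sG f) sD ⟨sD, sQ f true, 0⟩ [] L2
def chk3 : Bool := bs.all fun f => bs.all fun b =>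
  phaseB 3 f (sQ f b) sD ⟨sD, sZ f b, z3 f⟩ [⟨sD, sR f b, 0⟩] (L3 f)
def chk4 : Bool := bs.all fun f => bs.all fun b => idB 7 f (sR f b) && idB 7 f (sS f b)


def ord (f : Bool) : List (ℤ × ℤ) :=
  (if f then [(0,1),(0,2),(-1,0),(-1,1),(-1,2),(-1,3),(-1,-1),(-1,-2),(-1,-3),(-1,-4),(-1,-5),(-1,-6),
      (0,3),(0,4),(-1,4),(0,-3),(0,-4),(0,-5),(0,-6),(0,-2),(0,-1)]
   else [(-1,-2),(-1,-1),(0,-1),(0,0),(0,1),(0,2),(-1,0),(-1,1),(-1,2),(-1,3),(0,3),(0,4),(-1,4),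
      (0,-4),(0,-5),(0,-6),(-1,-4),(-1,-3),(-1,-5),(-1,-6),(0,-3),(0,-2)]) ++
  [(1,-2),(1,-1),(2,-1),(2,0),(2,1),(2,2),(1,0),(1,1),(1,2),(1,3)]

def fixd (f : Bool) : List (ℤ × ℤ) :=
  if f then [(0,0)] else
    [(-2,-6),(-2,-5),(-2,-4),(-2,-3),(-2,-2),(-2,-1),(-2,0),(-2,1),(-2,2),(-2,3),(-2,4)]

def okv (Q0 : List (ℤ × ℤ)) (as : List ((ℤ × ℤ) × Bool)) : Bool :=
  as.all (fun x => decide (0 < x.1.1) || !x.2) ||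
  as.all (fun x => decide (0 < x.1.1) || decide (x.2 = decide (x.1 ∈ Q0)))

/-- cut check for a block -/
def cutB (τ : ℕ) (f : Bool) (X nx : St) (Q0 : List (ℤ × ℤ)) : Bool :=
  (prevs f).all fun a =>
    bt (conf (tri a X nx)) τ (okv Q0)
      ((ord f).filter fun p => (conf (tri a X nx) p).isSome)
      ((fixd f).map fun p => (p, false)) 0

def Qa : List (ℤ × ℤ) := [(0,3),(0,4),(-1,4)]
def Qz (f : Bool) : List (ℤ × ℤ) := if f then [(0,-1),(0,-2)] else [(0,-2),(0,-3)]

def chkC : Bool := bs.all fun f => bs.all fun b => cutB 9 f (sD f b) (sG false) []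
def chkC2 : Bool := bs.all fun f => cutB 9 f (sP f) sE Qa && cutB 9 f (sG f) sE []
def chkC4 : Bool := bs.all fun f => bs.all fun b =>
  cutB 7 f (sR f b) sE (Qz f) && cutB 7 f (sS f b) sE []

def diffB (X X0 : St) (Q0 : List (ℤ × ℤ)) : Bool :=
  cells.all fun p => decide ((if p ∈ Q0 then none else cell X (p.1 + 1) (p.2 + 6)) =
    cell X0 (p.1 + 1) (p.2 + 6))

def remB (τ : ℕ) (f : Bool) (X X0 : St) (Q0 : List (ℤ × ℤ)) : Bool :=
  diffB X X0 Q0 && (Q0.all fun p => decide (p ∈ cells) && (cell X (p.1 + 1) (p.2 + 6)).isSome) &&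
  ((prevs f).all fun a => decide (cutStrength G (conf (tri a X sE)) Q0.toFinset < τ)) &&
  decide ((0, 0) ∉ Q0 ∧ Q0 ≠ [])

def chkR : Bool := bs.all fun f => remB 9 f (sP f) (sG f) Qa &&
  bs.all fun b => remB 7 f (sR f b) (sS f b) (Qz f)

theorem chkA_eq : chkA = true := by decide +kernel
theorem chk1_eq : chk1 = true := by decide +kernel
theorem chk2_eq : chk2 = true := by decide +kernel
theorem chk3_eq : chk3 = true := by decide +kernel
theorem chk4_eq : chk4 = true := by decide +kernel
theorem chkC_eq : chkC = true := by decide +kernel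
theorem chkC2_eq : chkC2 = true := by decide +kernel
theorem chkC4_eq : chkC4 = true := by decide +kernel
theorem chkR_eq : chkR = true := by decide +kernel


theorem G_zero : G 0 = 0 := rfl

theorem G_le (x : Glue) : G x ≤ 9 := by
  unfold G
  by_cases h : x < gl.length
  · rw [List.getD_eq_getElem _ _ h]
    have : ∀ y ∈ gl, y ≤ 9 := by decide
    exact this _ (List.getElem_mem h)
  · rw [List.getD_eq_default _ _ (not_lt.1 h)]; omega

theorem bs_all {f : Bool → Bool} (h : bs.all f = true) (b : Bool) : f b = true := by
  simp [bs] at h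
  cases b <;> simp [h]

theorem mem_cells {x y : ℤ} (hx : x = -1 ∨ x = 0) (h1 : -7 ≤ y) (h2 : y ≤ 5) :
    (x, y) ∈ cells := by
  rcases hx with rfl | rfl <;> interval_cases y <;> decide

theorem cell_out (s : St) (c y : ℤ) (h : y < 0 ∨ 11 ≤ y) : cell s c y = none := by
  have h0 : (col0 s).length = 11 := by unfold col0; split_ifs <;> rfl
  have h1 : (col1 s).length = 11 := by unfold col1; split_ifs <;> rfl
  have hn : ∀ l : List (Option Tile), l.length = 11 → nth l y = none := by
    intro l hl
    unfold nth
    cases y with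
    | ofNat n => exact List.getD_eq_default _ _ (by simp at h; omega)
    | negSucc n => rfl
  unfold cell
  split_ifs <;> simp [hn, h0, h1]

theorem conf_loc (st : ℤ → St) (k x y : ℤ) (h1 : -3 ≤ x) (h2 : x ≤ 2) :
    conf st (x + 2 * k, y) = conf (tri (st (k - 1)) (st k) (st (k + 1))) (x, y) := by
  unfold conf
  simp only
  have e1 : (x + 2 * k + 1) % 2 = (x + 1) % 2 := by omega
  have e2 : (x + 2 * k + 1) / 2 = (x + 1) / 2 + k := by omega
  rw [e1, e2]
  congr 1
  have : (x + 1) / 2 = -1 ∨ (x + 1) / 2 = 0 ∨ (x + 1) / 2 = 1 := by omega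
  rcases this with h | h | h <;> rw [h] <;> simp [tri]
  · congr 1; omega
  · congr 1; omega

theorem conf_cell (st : ℤ → St) (k x y : ℤ) (hx : x = -1 ∨ x = 0) :
    conf st (x + 2 * k, y) = cell (st k) (x + 1) (y + 6) := by
  unfold conf
  simp only
  have e1 : (x + 2 * k + 1) % 2 = x + 1 := by omega
  have e2 : (x + 2 * k + 1) / 2 = k := by omega
  rw [e1, e2]

theorem conf_out (st : ℤ → St) (x y : ℤ) (h : y < -6 ∨ 5 ≤ y) : conf st (x, y) = none := by
  unfold conf
  exact cell_out _ _ _ (by simp; omega)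

theorem att_loc (st : ℤ → St) (k x y : ℤ) (t : Tile) (hx : x = -1 ∨ x = 0) :
    attachStrength G (conf st) t (x + 2 * k, y) =
      attachStrength G (conf (tri (st (k - 1)) (st k) (st (k + 1)))) t (x, y) := by
  rw [att_eq, att_eq]
  simp only
  rw [← conf_loc st k x (y + 1) (by omega) (by omega), ← conf_loc st k x (y - 1) (by omega) (by omega),
    ← conf_loc st k (x + 1) y (by omega) (by omega), ← conf_loc st k (x - 1) y (by omega) (by omega)]
  have e1 : x + 1 + 2 * k = x + 2 * k + 1 := by ring
  have e2 : x - 1 + 2 * k = x + 2 * k - 1 := by ring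
  rw [e1, e2]

theorem exists_loc (p : ℤ × ℤ) : ∃ k x y : ℤ, (x = -1 ∨ x = 0) ∧ p = (x + 2 * k, y) :=
  ⟨(p.1 + 1) / 2, p.1 - 2 * ((p.1 + 1) / 2), p.2, by omega, by ext <;> simp⟩

theorem obond_og (x : Glue) (f : Tile → Glue) (o : Option Tile) :
    obond G x f o = bond G x (og f o) := by
  cases o with
  | none =>
    change 0 = bond G x 0
    unfold bond
    by_cases h : x = 0
    · subst h; rfl
    · rw [if_neg h]
  | some u => rfl

theorem bond_le (x y : Glue) : bond G x y ≤ G y := by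
  unfold bond; split_ifs with h
  · rw [h]
  · omega

theorem att_out (st : ℤ → St) (t : Tile) (x y : ℤ) (h : y < -7 ∨ 5 < y) :
    attachStrength G (conf st) t (x, y) = 0 := by
  rw [att_eq]
  simp only
  rw [conf_out _ _ _ (by omega), conf_out _ _ _ (by omega), conf_out _ _ _ (by omega),
    conf_out _ _ _ (by omega)]
  rfl

theorem noAtt_sound {τ : ℕ} {gd a b c : St} {g : ℤ × ℤ → Tile → Bool}
    (h : noAtt τ gd a b c g = true) (hτ : 0 < τ) {x y : ℤ} (hx : x = -1 ∨ x = 0)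
    (hgd : cell gd (x + 1) (y + 6) = none) {t : Tile} (ht : t ∈ T)
    (ha : τ ≤ attachStrength G (conf (tri a b c)) t (x, y)) : g (x, y) t = true := by
  by_cases hy : y < -7 ∨ 5 < y
  · rw [att_out _ _ _ _ hy] at ha; omega
  have hm := List.all_eq_true.1 h (x, y) (mem_cells hx (by omega) (by omega))
  simp only [hgd, Option.isSome_none, Bool.false_or] at hm
  unfold siteC siteOK at hm
  rw [att_eq] at ha
  simp only [obond_og] at ha
  simp only at hm
  generalize og Tile.south (conf (tri a b c) (x, y + 1)) = n at *
  generalize og Tile.west (conf (tri a b c) (x + 1, y)) = e at *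
  generalize og Tile.north (conf (tri a b c) (x, y - 1)) = s at *
  generalize og Tile.east (conf (tri a b c) (x - 1, y)) = w at *
  rw [Bool.or_eq_true] at hm
  rcases hm with hm | hm
  · have := of_decide_eq_true hm
    have := bond_le t.north n
    have := bond_le t.east e
    have := bond_le t.south s
    have := bond_le t.west w
    omega
  · have := List.all_eq_true.1 hm t (by simpa [T] using ht)
    rw [Bool.or_eq_true] at this
    rcases this with h' | h'
    · have := of_decide_eq_true h'
      unfold sc at this
      omega
    · exact h'

/-! ### linear states -/

def lin (i : ℕ) (b : ℕ → Bool) (W : Bool → Bool → St) (X : St) (k : ℤ) : St :=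
  if k < 0 then sE else if k + 1 < i then sD (decide (k = 0)) (b k.toNat)
  else if k + 1 = i then W (decide (k = 0)) (b k.toNat)
  else if k = i then X else sE

section
variable {i : ℕ} {b : ℕ → Bool} {W : Bool → Bool → St} {X : St} {k : ℤ}

theorem lin_neg (h : k < 0) : lin i b W X k = sE := by simp [lin, h]
theorem lin_far (h0 : 0 ≤ k) (h : k + 1 < i) :
    lin i b W X k = sD (decide (k = 0)) (b k.toNat) := by
  simp [lin, h, not_lt.2 h0]
theorem lin_prev (h0 : 0 ≤ k) (h : k + 1 = i) :
    lin i b W X k = W (decide (k = 0)) (b k.toNat) := by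
  simp [lin, h, not_lt.2 h0]
theorem lin_cur (h : k = i) : lin i b W X k = X := by
  subst h; simp [lin]
theorem lin_gt (h : (i : ℤ) < k) : lin i b W X k = sE := by
  have h1 : ¬ k < 0 := by omega
  have h2 : ¬ k + 1 < i := by omega
  have h3 : ¬ k + 1 = i := by omega
  have h4 : ¬ k = i := by omega
  simp [lin, h1, h2, h3, h4]

theorem prevs_of_D (f b : Bool) : sD f b ∈ prevs false := by
  cases f <;> cases b <;> simp [prevs]

theorem lin_prevs (h0 : 0 ≤ k) (h : k < i) : lin i b W X (k - 1) ∈ prevs (decide (k = 0)) := by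
  by_cases hk : k = 0
  · rw [lin_neg (by omega)]; simp [hk, prevs]
  · rw [lin_far (by omega) (by omega)]
    simp only [hk, decide_false]
    exact prevs_of_D _ _

theorem lin_prevs_cur : lin i b sD X ((i : ℤ) - 1) ∈ prevs (decide (i = 0)) := by
  by_cases hk : i = 0
  · rw [lin_neg (by omega)]; simp [hk, prevs]
  · rw [lin_prev (by omega) (by omega)]
    simp only [hk, decide_false]
    exact prevs_of_D _ _
end

theorem fitE_sE {p t} : fitE sE p t = true → False := by
  simp [fitE, cell, sE]

theorem fitE_conf {st : ℤ → St} {k x y : ℤ} {t : Tile} (hx : x = -1 ∨ x = 0)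
    (h : fitE (st k) (x, y) t = true) : conf st (x + 2 * k, y) = some t := by
  rw [conf_cell st k x y hx]
  exact of_decide_eq_true h

def sft (i : ℕ) (p : ℤ × ℤ) : ℤ × ℤ := (p.1 + 2 * i, p.2)

theorem chkA_far {τ : ℕ} (hτ : τ ∈ ct) (f b c : Bool) {a : St} (ha : a ∈ prevs f) :
    noAtt τ (sD f b) a (sD f b) (sD false c) (fitE (sD f b)) = true := by
  have h := chkA_eq
  unfold chkA at h
  rw [Bool.and_eq_true] at h
  have h1 := List.all_eq_true.1 h.1 τ hτ
  exact List.all_eq_true.1 (bs_all (bs_all (bs_all h1 f) b) c) a ha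

theorem chkA_end {τ : ℕ} (hτ : τ ∈ ct) : noAtt τ sE sE sE sE (fitE sE) = true ∧
    ∀ b, noAtt τ sE sE sE (sD true b) (fitE sE) = true := by
  have h := chkA_eq
  unfold chkA at h
  rw [Bool.and_eq_true] at h
  have h1 := List.all_eq_true.1 h.2 τ hτ
  unfold cEnd at h1
  rw [Bool.and_eq_true] at h1
  exact ⟨h1.1, bs_all h1.2⟩

theorem stg_sound {τ : ℕ} (hτ : τ ∈ ct) {i : ℕ} {b : ℕ → Bool} {gd : St}
    {gp : Bool → Bool → St} {zs : List (ℤ × ℤ)} {s n : Sg}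
    (h : stg τ (decide (i = 0)) gd gp zs s n = true) :
    ∀ t ∈ T, ∀ p, conf (lin i b gp gd) p = none →
      τ ≤ attachStrength G (conf (lin i b s.pv s.X)) t p →
      p ∈ zs.map (sft i) ∨ conf (lin i b s.pv s.X) p = some t ∨
      (p = sft i s.z ∧ conf (lin i b n.pv n.X) p = some t) := by
  have hpos : 0 < τ := by
    simp [ct] at hτ; omega
  intro t ht p hp ha
  obtain ⟨k, x, y, hx, rfl⟩ := exists_loc p
  rw [conf_cell _ _ _ _ hx] at hp
  rw [att_loc _ _ _ _ _ hx] at ha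
  unfold stg at h
  rw [Bool.and_eq_true] at h
  obtain ⟨hnext, h⟩ := h
  have fin : ∀ {gd' a b' c : St}, lin i b gp gd k = gd' → lin i b s.pv s.X (k - 1) = a →
      lin i b s.pv s.X k = b' → lin i b s.pv s.X (k + 1) = c →
      ∀ {g}, noAtt τ gd' a b' c g = true → g (x, y) t = true := by
    intro gd' a b' c h1 h2 h3 h4 g hg
    rw [h1] at hp
    rw [h2, h3, h4] at ha
    exact noAtt_sound hg hpos hx hp ht ha
  by_cases hk1 : k < -1
  · exact (fitE_sE (fin (lin_neg (by omega)) (lin_neg (by omega)) (lin_neg (by omega))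
      (lin_neg (by omega)) (chkA_end hτ).1)).elim
  by_cases hk2 : (i : ℤ) + 1 < k
  · exact (fitE_sE (fin (lin_gt (by omega)) (lin_gt (by omega)) (lin_gt (by omega))
      (lin_gt (by omega)) (chkA_end hτ).1)).elim
  by_cases hk3 : k = i + 1
  · exact (fitE_sE (fin (lin_gt (by omega)) (lin_cur (by omega)) (lin_gt (by omega))
      (lin_gt (by omega)) hnext)).elim
  by_cases hi : i = 0
  · simp only [hi, decide_true, if_true, Bool.and_eq_true] at h
    by_cases hk4 : k = -1
    · exact (fitE_sE (fin (lin_neg (by omega)) (lin_neg (by omega)) (lin_neg (by omega))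
        (lin_cur (by omega)) h.1)).elim
    · have hk : k = i := by omega
      have hg := fin (lin_cur hk) (lin_neg (by omega)) (lin_cur hk) (lin_gt (by omega)) h.2
      unfold good at hg
      simp only [Bool.or_eq_true, Bool.and_eq_true, decide_eq_true_eq, sub_zero] at hg
      rcases hg with (hg | hg) | ⟨hg, hg'⟩
      · left
        exact List.mem_map.2 ⟨_, hg, by simp [sft, hk]⟩
      · right; left
        exact fitE_conf hx (by rw [lin_cur hk]; exact hg)
      · right; right
        exact ⟨by simp [sft, ← hg, hk], fitE_conf hx (by rw [lin_cur hk]; exact hg')⟩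
  · simp only [hi, decide_false, Bool.false_eq_true, if_false] at h
    have h' := fun b => (Bool.and_eq_true _ _).mp (bs_all h b)
    have hE := fun b => (h' b).1
    have hI := fun b f => ((Bool.and_eq_true _ _).mp (bs_all (h' b).2 f)).1
    have hP := fun b f a (ha : a ∈ prevs f) => (Bool.and_eq_true _ _).mp
      (List.all_eq_true.1 ((Bool.and_eq_true _ _).mp (bs_all (h' b).2 f)).2 a ha)
    by_cases hk4 : k = -1
    · by_cases hi1 : i = 1
      · refine (fitE_sE (fin (lin_neg (by omega)) (lin_neg (by omega)) (lin_neg (by omega))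
          (lin_prev (by omega) (by omega)) ?_)).elim
        simp only [hk4]
        exact hE _
      · refine (fitE_sE (fin (lin_neg (by omega)) (lin_neg (by omega)) (lin_neg (by omega))
          (lin_far (by omega) (by omega)) ?_)).elim
        simp only [hk4]
        exact (chkA_end hτ).2 _
    by_cases hk5 : k = i
    · have hg := fin (lin_cur hk5) (lin_prev (by omega) (by omega)) (lin_cur hk5)
        (lin_gt (by omega)) (hI _ _)
      unfold good at hg
      simp only [Bool.or_eq_true, Bool.and_eq_true, decide_eq_true_eq, sub_zero] at hg
      rcases hg with (hg | hg) | ⟨hg, hg'⟩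
      · left
        exact List.mem_map.2 ⟨_, hg, by simp [sft, hk5]⟩
      · right; left
        exact fitE_conf hx (by rw [lin_cur hk5]; exact hg)
      · right; right
        exact ⟨by simp [sft, ← hg, hk5], fitE_conf hx (by rw [lin_cur hk5]; exact hg')⟩
    have hpv := lin_prevs (b := b) (W := s.pv) (X := s.X) (i := i) (k := k) (by omega) (by omega)
    by_cases hk6 : k + 1 = i
    · have hg := fin (lin_prev (by omega) hk6) rfl (lin_prev (by omega) hk6)
        (lin_cur (by omega)) (hP _ _ _ hpv).1
      unfold good at hg
      simp only [Bool.or_eq_true, Bool.and_eq_true, decide_eq_true_eq] at hg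
      have hs : sft i (x - 2, y) = (x + 2 * k, y) := by
        simp [sft]; omega
      rcases hg with (hg | hg) | ⟨hg, hg'⟩
      · left
        exact List.mem_map.2 ⟨_, hg, hs⟩
      · right; left
        exact fitE_conf hx (by rw [lin_prev (by omega) hk6]; exact hg)
      · right; right
        exact ⟨by rw [← hg, hs], fitE_conf hx (by rw [lin_prev (by omega) hk6]; exact hg')⟩
    right; left
    have hk7 : decide (k + 1 = 0) = false := by simp; omega
    by_cases hk8 : k + 2 = i
    · refine fitE_conf hx ?_
      rw [lin_far (by omega) (by omega)]
      refine fin (lin_far (by omega) (by omega)) rfl (lin_far (by omega) (by omega))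
        (lin_prev (by omega) (by omega)) ?_
      rw [hk7]
      exact bs_all (hP _ _ _ hpv).2 _
    · refine fitE_conf hx ?_
      rw [lin_far (by omega) (by omega)]
      refine fin (lin_far (by omega) (by omega)) rfl (lin_far (by omega) (by omega))
        (lin_far (by omega) (by omega)) ?_
      rw [hk7]
      exact chkA_far hτ _ _ _ hpv


theorem leB_sub {s s' : St} (h : leB s s' = true) {x y : ℤ} (hx : x = -1 ∨ x = 0) {t : Tile}
    (ht : cell s (x + 1) (y + 6) = some t) : cell s' (x + 1) (y + 6) = some t := by
  by_cases hy : y < -6 ∨ 5 ≤ y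
  · rw [cell_out _ _ _ (by omega)] at ht; cases ht
  · have hm := List.all_eq_true.1 h (x, y) (mem_cells hx (by omega) (by omega))
    simp only [ht, Option.isNone_some, Bool.false_or, decide_eq_true_eq] at hm
    exact hm.symm

theorem conf_sub {st st' : ℤ → St} (h : ∀ k, leB (st k) (st' k) = true) :
    Sub (conf st) (conf st') := by
  intro p t hp
  obtain ⟨k, x, y, hx, rfl⟩ := exists_loc p
  rw [conf_cell _ _ _ _ hx] at hp ⊢
  exact leB_sub (h k) hx hp

theorem leB_refl (s : St) : leB s s = true := by
  apply List.all_eq_true.2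
  intro p _
  simp

theorem lin_sub {i : ℕ} {b : ℕ → Bool} {W W' : Bool → Bool → St} {X X' : St}
    (hW : leP W W' = true) (hX : leB X X' = true) :
    Sub (conf (lin i b W X)) (conf (lin i b W' X')) := by
  apply conf_sub
  intro k
  unfold lin
  split_ifs
  · exact leB_refl _
  · exact leB_refl _
  · exact bs_all (bs_all hW _) _
  · exact hX
  · exact leB_refl _

def cfg (i : ℕ) (b : ℕ → Bool) (s : Sg) : Config := conf (lin i b s.pv s.X)

def toL (i : ℕ) (b : ℕ → Bool) : Sg → List Sg → List ((ℤ × ℤ) × Config)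
  | _, [] => []
  | s, s' :: r => (sft i s.z, cfg i b s') :: toL i b s' r

theorem lastR_toL (i : ℕ) (b : ℕ → Bool) : ∀ (r : List Sg) (s : Sg),
    lastR (cfg i b s) (toL i b s r) = cfg i b (lastS s r)
  | [], _ => rfl
  | s' :: r, _ => lastR_toL i b r s'

theorem stgs_sound {τ : ℕ} (hτ : τ ∈ ct) {i : ℕ} {b : ℕ → Bool} {gd : St}
    {gp : Bool → Bool → St} : ∀ (r : List Sg) (zs : List (ℤ × ℤ)) (s : Sg),
    stgs τ (decide (i = 0)) gd gp zs s r = true →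
    GrowOK T G τ (conf (lin i b gp gd)) (zs.map (sft i)) (cfg i b s) (toL i b s r)
  | [], zs, s, h => by
      intro t ht p hp ha
      rcases stg_sound hτ h t ht p hp ha with h | h | h
      · exact Or.inl h
      · exact Or.inr h
      · exact Or.inr h.2
  | s' :: r, zs, s, h => by
      unfold stgs at h
      simp only [Bool.and_eq_true] at h
      obtain ⟨⟨⟨h1, h2⟩, h3⟩, h4⟩ := h
      refine ⟨stg_sound hτ h1, lin_sub h3 h2, ?_⟩
      exact stgs_sound hτ r (s.z :: zs) s' h4

theorem tri_sub_lin {i : ℕ} {b : ℕ → Bool} {W : Bool → Bool → St} {X : St} {k x y : ℤ}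
    (hx : -3 ≤ x) (hx2 : x ≤ 2) :
    conf (tri (lin i b W X (k - 1)) (lin i b W X k) (lin i b W X (k + 1))) (x, y) =
      conf (lin i b W X) (x + 2 * k, y) := (conf_loc _ _ _ _ hx hx2).symm

/-- translate a configuration -/
def sh (C : Config) (k : ℤ) : Config := fun p => C (p.1 + 2 * k, p.2)

theorem att_sh (C : Config) (k : ℤ) (t : Tile) (p : ℤ × ℤ) :
    attachStrength G (sh C k) t p = attachStrength G C t (p.1 + 2 * k, p.2) := by
  rw [att_eq, att_eq]
  unfold sh
  have e1 : p.1 + 1 + 2 * k = p.1 + 2 * k + 1 := by ring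
  have e2 : p.1 - 1 + 2 * k = p.1 + 2 * k - 1 := by ring
  simp only [e1, e2]

theorem tri_sub_sh (st : ℤ → St) (k : ℤ) {a c : St}
    (ha : a = sE ∨ leB a (st (k - 1)) = true) (hc : c = sE ∨ leB c (st (k + 1)) = true) :
    Sub (conf (tri a (st k) c)) (sh (conf st) k) := by
  have hsh : sh (conf st) k = conf (fun j => st (j + k)) := by
    funext p
    unfold sh conf
    simp only
    have e1 : (p.1 + 2 * k + 1) % 2 = (p.1 + 1) % 2 := by omega
    have e2 : (p.1 + 2 * k + 1) / 2 = (p.1 + 1) / 2 + k := by omega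
    rw [e1, e2]
  have hE : ∀ s, leB sE s = true := by
    intro s
    apply List.all_eq_true.2
    intro p _
    simp [cell, sE]
  rw [hsh]
  apply conf_sub
  intro j
  unfold tri
  split_ifs with h1 h2 h3
  · subst h1; simp only [zero_add]; exact leB_refl _
  · subst h2
    rcases ha with rfl | ha
    · exact hE _
    · rw [show (-1 : ℤ) + k = k - 1 by ring]; exact ha
  · subst h3
    rcases hc with rfl | hc
    · exact hE _
    · rw [show (1 : ℤ) + k = k + 1 by ring]; exact hc
  · exact hE _

theorem gchk_sound {τ : ℕ} {Cl Dl E D : Config} {k : ℤ} (hED : Sub E D)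
    (hC : Sub Cl (sh E k)) (hD : Sub Dl (sh D k)) :
    ∀ (L e : List (ℤ × ℤ)), gchk τ Cl Dl e L = true → (∀ p ∈ e, sh E k p ≠ none) →
      (∀ p ∈ L, sh E k p ≠ none) ∨
        ∃ p t, t ∈ T ∧ E p = none ∧ τ ≤ attachStrength G E t p
  | [], _, _, _ => Or.inl (by simp)
  | p :: ps, e, h, he => by
      unfold gchk at h
      rw [Bool.and_eq_true] at h
      obtain ⟨h1, h2⟩ := h
      cases hDp : Dl p with
      | none => simp [hDp] at h1
      | some t =>
        simp only [hDp, Bool.and_eq_true, decide_eq_true_eq] at h1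
        by_cases hp : sh E k p = none
        · right
          refine ⟨(p.1 + 2 * k, p.2), t, by simpa [T] using h1.1, hp, ?_⟩
          rw [← att_sh]
          refine h1.2.trans (att_mono ?_ t p)
          intro q u hq
          unfold ov at hq
          split_ifs at hq with hqe
          · have hEq := he q hqe
            have : sh E k q = sh D k q := Sub.eq (C := sh E k) (D := sh D k)
              (fun r v hr => hED _ v hr) hEq
            rw [this]
            exact hD q u hq
          · exact hC q u hq
        · rcases gchk_sound hED hC hD ps (p :: e) h2 (by
            intro q hq
            rcases List.mem_cons.1 hq with rfl | hq
            · exact hp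
            · exact he q hq) with h | h
          · left
            intro q hq
            rcases List.mem_cons.1 hq with rfl | hq
            · exact hp
            · exact h q hq
          · exact Or.inr h

theorem gchk_some {τ : ℕ} {Cl Dl : Config} : ∀ (L e : List (ℤ × ℤ)),
    gchk τ Cl Dl e L = true → ∀ p ∈ L, Dl p ≠ none
  | [], _, _ => by simp
  | p :: ps, e, h => by
      unfold gchk at h
      rw [Bool.and_eq_true] at h
      obtain ⟨h1, h2⟩ := h
      intro q hq
      rcases List.mem_cons.1 hq with rfl | hq
      · intro hn; simp [hn] at h1
      · exact gchk_some ps _ h2 q hq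

theorem newIn_sound {C D : St} {d : ℤ} {L : List (ℤ × ℤ)} (h : newIn C D d L = true) {x y : ℤ}
    (hx : x = -1 ∨ x = 0) (hD : cell D (x + 1) (y + 6) ≠ none)
    (hC : cell C (x + 1) (y + 6) = none) : (x - d, y) ∈ L := by
  by_cases hy : y < -6 ∨ 5 ≤ y
  · exact absurd (cell_out _ _ _ (by omega)) hD
  · have hm := List.all_eq_true.1 h (x, y) (mem_cells hx (by omega) (by omega))
    simpa [hC, hD] using hm

theorem sE_cell (c y : ℤ) : cell sE c y = none := rfl

theorem phase {τ : ℕ} (hτ : τ ∈ ct) {i : ℕ} {b : ℕ → Bool} {gd : St}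
    {gp : Bool → Bool → St} {s : Sg} {r : List Sg} {L : Bool → List (ℤ × ℤ)}
    (h : phaseB τ (decide (i = 0)) gd gp s r L = true)
    (hS : Stable G τ (conf (lin i b gp gd))) :
    PhaseTo (Step T G τ) (conf (lin i b gp gd)) (cfg i b (lastS s r)) ∧
      Stable G τ (cfg i b (lastS s r)) := by
  unfold phaseB at h
  simp only [Bool.and_eq_true] at h
  obtain ⟨⟨⟨h1, h2⟩, h3⟩, h4⟩ := h
  set e := lastS s r with he
  -- the window list
  obtain ⟨Lw, W, V, hnew, hg, hWs, hVs⟩ : ∃ (Lw : List (ℤ × ℤ)) (A A' : St),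
      (∀ p, cfg i b e p ≠ none → conf (lin i b gp gd) p = none → p ∈ Lw.map (sft i)) ∧
      gchk τ (conf (tri A gd sE)) (conf (tri A' e.X sE)) [] Lw = true ∧
      (A = sE ∨ leB A (lin i b gp gd ((i : ℤ) - 1)) = true) ∧
      (A' = sE ∨ leB A' (lin i b e.pv e.X ((i : ℤ) - 1)) = true) := by
    unfold gro at h4
    by_cases hi : i = 0
    · simp only [hi, decide_true, if_true, Bool.and_eq_true] at h4
      refine ⟨_, _, _, ?_, h4.2, Or.inl rfl, Or.inl rfl⟩
      intro p hD hC
      obtain ⟨k, x, y, hx, rfl⟩ := exists_loc p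
      unfold cfg at hD
      rw [conf_cell _ _ _ _ hx] at hD hC
      by_cases hk : k = i
      · rw [lin_cur hk] at hD hC
        have := newIn_sound h4.1 hx hD hC
        refine List.mem_map.2 ⟨_, this, by simp [sft, hk]⟩
      · exfalso
        rcases lt_or_gt_of_ne hk with h | h
        · rw [lin_neg (by omega)] at hD; exact hD (sE_cell _ _)
        · rw [lin_gt (by omega)] at hD; exact hD (sE_cell _ _)
    · simp only [hi, decide_false, Bool.false_eq_true, if_false] at h4
      have h5 := bs_all (bs_all h4 (decide ((i : ℤ) - 1 = 0))) (b ((i : ℤ) - 1).toNat)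
      simp only [Bool.and_eq_true] at h5
      have hpg : lin i b gp gd ((i : ℤ) - 1) = _ := lin_prev (by omega) (by omega)
      have hpe : lin i b e.pv e.X ((i : ℤ) - 1) = _ := lin_prev (by omega) (by omega)
      refine ⟨_, _, _, ?_, h5.2, Or.inr ?_, Or.inr ?_⟩
      · intro p hD hC
        obtain ⟨k, x, y, hx, rfl⟩ := exists_loc p
        unfold cfg at hD
        rw [conf_cell _ _ _ _ hx] at hD hC
        by_cases hk : k = i
        · rw [lin_cur hk] at hD hC
          have := newIn_sound h5.1.1 hx hD hC
          refine List.mem_map.2 ⟨_, this, by simp [sft, hk]⟩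
        by_cases hk' : k = (i : ℤ) - 1
        · rw [hk', hpe] at hD
          rw [hk', hpg] at hC
          have := newIn_sound h5.1.2 hx hD hC
          refine List.mem_map.2 ⟨_, this, ?_⟩
          simp [sft, hk']; ring
        exfalso
        rcases lt_or_gt_of_ne hk with h | h
        · by_cases h0 : k < 0
          · rw [lin_neg (by omega)] at hD; exact hD (sE_cell _ _)
          · rw [lin_far (by omega) (by omega)] at hD hC
            exact hD hC
        · rw [lin_gt (by omega)] at hD; exact hD (sE_cell _ _)
      · rw [hpg]; exact leB_refl _
      · rw [hpe]; exact leB_refl _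
  have hDs : Sub (conf (tri V e.X sE)) (sh (cfg i b e) i) := by
    have := tri_sub_sh (lin i b e.pv e.X) i hVs (Or.inl rfl)
    rwa [lin_cur rfl] at this
  have hCs : Sub (conf (tri W gd sE)) (sh (conf (lin i b gp gd)) i) := by
    have := tri_sub_sh (lin i b gp gd) i hWs (Or.inl rfl)
    rwa [lin_cur rfl] at this
  refine growth (N := (Lw.map (sft i)).toFinset) (lin_sub h2 h1) (lastR_toL i b r s) hS
    (stgs_sound hτ r [] s h3) ?_ ?_ ?_
  · intro p hD hC
    exact List.mem_toFinset.2 (hnew p hD hC)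
  · intro p hp
    rw [List.mem_toFinset, List.mem_map] at hp
    obtain ⟨q, hq, rfl⟩ := hp
    exact hDs.ne (gchk_some _ _ hg q hq)
  · intro E hCE hED
    rcases gchk_sound hED (hCs.trans (fun q u hq => hCE _ u hq)) hDs Lw [] hg (by simp) with h | h
    · left
      intro p hp
      rw [List.mem_toFinset, List.mem_map] at hp
      obtain ⟨q, hq, rfl⟩ := hp
      exact h q hq
    · exact Or.inr h


def asgn (Q : Finset (ℤ × ℤ)) (l : List (ℤ × ℤ)) : List ((ℤ × ℤ) × Bool) :=
  l.map fun p => (p, decide (p ∈ Q))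

def pairSum (C : Config) : List ((ℤ × ℤ) × Bool) → ℕ
  | [] => 0
  | (p, v) :: r => pairSum C r + dl C p v r

theorem dl_eq (C : Config) (Q : Finset (ℤ × ℤ)) (p : ℤ × ℤ) (v : Bool) :
    ∀ l : List (ℤ × ℤ), l.Nodup →
      dl C p v (asgn Q l) = ∑ q ∈ l.toFinset with decide (q ∈ Q) ≠ v, bondAt G C p q
  | [], _ => rfl
  | q :: l, h => by
      rw [List.nodup_cons] at h
      have ih := dl_eq C Q p v l h.2
      unfold asgn at ih ⊢
      rw [List.map_cons, dl, ih, List.toFinset_cons, Finset.filter_insert]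
      by_cases hq : decide (q ∈ Q) = v
      · simp [hq]
      · rw [if_neg hq, if_pos hq, Finset.sum_insert]
        simp [h.1]

theorem pairSum_eq (C : Config) (Q : Finset (ℤ × ℤ)) : ∀ l : List (ℤ × ℤ), l.Nodup →
    pairSum C (asgn Q l) =
      ∑ p ∈ l.toFinset with p ∈ Q, ∑ q ∈ l.toFinset with q ∉ Q, bondAt G C p q
  | [], _ => rfl
  | p :: l, h => by
      rw [List.nodup_cons] at h
      have ih := pairSum_eq C Q l h.2
      have hd := dl_eq C Q p (decide (p ∈ Q)) l h.2
      have e : asgn Q (p :: l) = (p, decide (p ∈ Q)) :: asgn Q l := rfl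
      rw [e, pairSum, ih, hd, List.toFinset_cons, Finset.filter_insert, Finset.filter_insert]
      by_cases hp : p ∈ Q
      · simp only [hp, not_true_eq_false, if_true, if_false]
        rw [Finset.sum_insert (by simp [h.1]), add_comm]
        congr 2
        ext q; simp
      · simp only [hp, not_false_eq_true, if_true, if_false]
        have : ∀ q ∈ l.toFinset.filter (· ∈ Q),
            ∑ r ∈ insert p (l.toFinset.filter (· ∉ Q)), bondAt G C q r =
            ∑ r ∈ l.toFinset.filter (· ∉ Q), bondAt G C q r + bondAt G C p q := by
          intro q _
          rw [Finset.sum_insert (by simp [h.1]), bondAt_symm, add_comm]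
        rw [Finset.sum_congr rfl this, Finset.sum_add_distrib]
        congr 2
        ext q; simp

theorem pairSum_le (C : Config) (Q : Finset (ℤ × ℤ)) (l : List (ℤ × ℤ)) (h : l.Nodup) :
    pairSum C (asgn Q l) ≤ cutStrength G C Q := by
  rw [pairSum_eq C Q l h]
  unfold cutStrength
  calc _ ≤ ∑ p ∈ l.toFinset with p ∈ Q, outStrength G C Q p := by
        apply Finset.sum_le_sum
        intro p _
        apply out_ge
        rw [Finset.disjoint_left]
        intro q hq
        exact (Finset.mem_filter.1 hq).2
    _ ≤ _ := by
        apply Finset.sum_le_sum_of_subset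
        intro q hq
        exact (Finset.mem_filter.1 hq).2

theorem bt_sound {C : Config} {τ : ℕ} {ok : List ((ℤ × ℤ) × Bool) → Bool}
    {Q : Finset (ℤ × ℤ)} (hcut : cutStrength G C Q < τ) :
    ∀ (ps K : List (ℤ × ℤ)) (acc : ℕ), (ps.reverse ++ K).Nodup →
      bt C τ ok ps (asgn Q K) acc = true → acc ≤ pairSum C (asgn Q K) →
      ok (asgn Q (ps.reverse ++ K)) = true
  | [], K, acc, hn, h, hacc => by
      unfold bt at h
      rw [Bool.or_eq_true] at h
      rcases h with h | h
      · have := of_decide_eq_true h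
        have := pairSum_le C Q K (by simpa using hn)
        omega
      · simpa using h
  | p :: ps, K, acc, hn, h, hacc => by
      unfold bt at h
      rw [Bool.or_eq_true, Bool.and_eq_true] at h
      have hn' : (ps.reverse ++ (p :: K)).Nodup := by simpa using hn
      have hK : K.Nodup := by
        have := (List.nodup_append.1 hn').2.1
        exact (List.nodup_cons.1 this).2
      rcases h with h | h
      · have := of_decide_eq_true h
        have := pairSum_le C Q K hK
        omega
      · have key : bt C τ ok ps (asgn Q (p :: K)) (acc + dl C p (decide (p ∈ Q)) (asgn Q K)) =
            true := by
          have e : asgn Q (p :: K) = (p, decide (p ∈ Q)) :: asgn Q K := rfl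
          rw [e]
          by_cases hp : p ∈ Q
          · simp only [hp, decide_true]; exact h.2
          · simp only [hp, decide_false]; exact h.1
        have := bt_sound hcut ps (p :: K) _ hn' key (by
          show acc + dl C p (decide (p ∈ Q)) (asgn Q K) ≤
            pairSum C (asgn Q K) + dl C p (decide (p ∈ Q)) (asgn Q K)
          exact Nat.add_le_add_right hacc _)
        simpa using this

theorem bondAt_sh (C : Config) (k : ℤ) (p q : ℤ × ℤ) :
    bondAt G (sh C k) p q = bondAt G C (p.1 + 2 * k, p.2) (q.1 + 2 * k, q.2) := by
  obtain ⟨a, b⟩ := p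
  obtain ⟨c, d⟩ := q
  unfold bondAt sh
  simp only
  cases C (a + 2 * k, b) <;> cases C (c + 2 * k, d) <;> simp only
  unfold edgeBond
  simp only [Prod.mk.injEq]
  split_ifs <;> first | rfl | (exfalso; omega)

def win (k : ℤ) (Q : Finset (ℤ × ℤ)) : Finset (ℤ × ℤ) := Q.image fun p => (p.1 - 2 * k, p.2)

theorem mem_win {k x y : ℤ} {Q : Finset (ℤ × ℤ)} : (x, y) ∈ win k Q ↔ (x + 2 * k, y) ∈ Q := by
  unfold win
  rw [Finset.mem_image]
  constructor
  · rintro ⟨⟨a, b⟩, h, e⟩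
    simp only [Prod.mk.injEq] at e
    obtain ⟨rfl, rfl⟩ := e
    simpa using h
  · intro h
    exact ⟨_, h, by simp⟩

theorem cut_win (C : Config) (k : ℤ) (Q : Finset (ℤ × ℤ)) :
    cutStrength G (sh C k) (win k Q) = cutStrength G C Q := by
  unfold cutStrength
  conv_lhs => unfold win
  rw [Finset.sum_image]
  · apply Finset.sum_congr rfl
    rintro ⟨a, b⟩ _
    unfold outStrength neighbors
    have e1 : a - 2 * k + 1 + 2 * k = a + 1 := by ring
    have e2 : a - 2 * k - 1 + 2 * k = a - 1 := by ring
    have e3 : a - 2 * k + 2 * k = a := by ring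
    change ((List.filter (fun q => decide (q ∉ win k Q)) [(a - 2 * k, b + 1),
      (a - 2 * k + 1, b), (a - 2 * k, b - 1), (a - 2 * k - 1, b)]).map _).sum = _
    simp only [List.filter_cons, mem_win, e1, e2, e3, List.filter_nil]
    split_ifs <;> simp [bondAt_sh, e1, e2, e3]
  · rintro ⟨a, b⟩ _ ⟨c, d⟩ _ h
    simp only [Prod.mk.injEq] at h ⊢
    omega

theorem ord_nodup (f : Bool) : (ord f ++ fixd f).Nodup := by cases f <;> decide

theorem ord_cover (f : Bool) {x y : ℤ} (hx : x = -1 ∨ x = 0) (h1 : -6 ≤ y) (h2 : y < 5) :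
    (x, y) ∈ ord f ∨ (x, y) ∈ fixd f := by
  rcases hx with rfl | rfl <;> interval_cases y <;> cases f <;> decide

theorem cutB_sound {τ : ℕ} {f : Bool} {X nx : St} {Q0 : List (ℤ × ℤ)}
    (h : cutB τ f X nx Q0 = true) {st : ℤ → St} {k : ℤ} (hX : st k = X)
    (hp : st (k - 1) ∈ prevs f) (hnx : nx = sE ∨ leB nx (st (k + 1)) = true)
    {Q : Finset (ℤ × ℤ)} (hcut : cutStrength G (conf st) Q < τ)
    (hfix : ∀ p ∈ fixd f, p ∉ win k Q) :
    (∀ x y : ℤ, (x = -1 ∨ x = 0) → conf st (x + 2 * k, y) ≠ none → (x + 2 * k, y) ∉ Q) ∨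
    (∀ x y : ℤ, (x = -1 ∨ x = 0) → conf st (x + 2 * k, y) ≠ none →
      ((x + 2 * k, y) ∈ Q ↔ (x, y) ∈ Q0)) := by
  have hb := List.all_eq_true.1 h _ hp
  have hsub : Sub (conf (tri (st (k - 1)) X nx)) (sh (conf st) k) := by
    have := tri_sub_sh st k (Or.inr (leB_refl (st (k - 1)))) hnx
    rwa [hX] at this
  have hloc : ∀ x y : ℤ, (x = -1 ∨ x = 0) → conf st (x + 2 * k, y) ≠ none →
      conf (tri (st (k - 1)) X nx) (x, y) ≠ none := by
    intro x y hx hc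
    rw [conf_cell _ _ _ _ hx, hX] at hc
    have := conf_cell (tri (st (k - 1)) X nx) 0 x y hx
    simp only [mul_zero, add_zero] at this
    rw [this]
    simpa [tri] using hc
  set C := conf (tri (st (k - 1)) X nx) with hC
  have hcut' : cutStrength G C (win k Q) < τ :=
    lt_of_le_of_lt ((cut_mono hsub _).trans_eq (cut_win _ _ _)) hcut
  have hfx : ((fixd f).map fun p => (p, false)) = asgn (win k Q) (fixd f) := by
    unfold asgn
    apply List.map_congr_left
    intro p hp
    simp [hfix p hp]
  rw [hfx] at hb
  set l := (ord f).filter fun p => (C p).isSome with hl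
  have hn : (l.reverse ++ fixd f).Nodup := by
    have h1 := ord_nodup f
    rw [List.nodup_append] at h1 ⊢
    refine ⟨List.nodup_reverse.2 (h1.1.filter _), h1.2.1, ?_⟩
    intro a ha c hc
    rw [List.mem_reverse, hl, List.mem_filter] at ha
    exact h1.2.2 a ha.1 c hc
  have hok := bt_sound hcut' l (fixd f) 0 hn hb (Nat.zero_le _)
  have hin : ∀ x y : ℤ, (x = -1 ∨ x = 0) → conf st (x + 2 * k, y) ≠ none →
      ((x, y), decide ((x + 2 * k, y) ∈ Q)) ∈ asgn (win k Q) (l.reverse ++ fixd f) := by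
    intro x y hx hc
    unfold asgn
    rw [List.mem_map]
    refine ⟨(x, y), ?_, by simp only [mem_win]⟩
    have hy : -6 ≤ y ∧ y < 5 := by
      by_contra hy
      exact hc (conf_out _ _ _ (by omega))
    rw [List.mem_append, List.mem_reverse, hl, List.mem_filter]
    rcases ord_cover f hx hy.1 hy.2 with h | h
    · exact Or.inl ⟨h, Option.isSome_iff_ne_none.2 (hloc x y hx hc)⟩
    · exact Or.inr h
  unfold okv at hok
  rw [Bool.or_eq_true] at hok
  rcases hok with hok | hok
  · left
    intro x y hx hc
    have := List.all_eq_true.1 hok _ (hin x y hx hc)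
    have h0 : ¬ (0 < x) := by omega
    simpa [h0] using this
  · right
    intro x y hx hc
    have := List.all_eq_true.1 hok _ (hin x y hx hc)
    have h0 : ¬ (0 < x) := by omega
    simpa [h0] using this

theorem chkC_cut (f b : Bool) : cutB 9 f (sD f b) (sG false) [] = true :=
  bs_all (bs_all chkC_eq f) b

theorem sG_le_sD (b : Bool) : leB (sG false) (sD false b) = true := by
  cases b <;> decide +kernel

theorem low_cut {τ i : ℕ} {b : ℕ → Bool} {X : St} {Q0 : List (ℤ × ℤ)} (hτ : τ ≤ 9)
    (h : cutB τ (decide (i = 0)) X sE Q0 = true)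
    (hX : i ≠ 0 → leB (sG false) X = true)
    (hQ0 : ∀ p ∈ Q0, p ∈ cells ∧ (cell X (p.1 + 1) (p.2 + 6)).isSome = true)
    {Q : Finset (ℤ × ℤ)} (hQ : Q.Nonempty) (h0 : ((0, 0) : ℤ × ℤ) ∉ Q)
    (hs : (↑Q : Set (ℤ × ℤ)) ⊆ shape (conf (lin i b sD X)))
    (hcut : cutStrength G (conf (lin i b sD X)) Q < τ) :
    Q = Q0.toFinset.image (sft i) := by
  set st := lin i b sD X with hst
  have hblk : ∀ x y k : ℤ, (x = -1 ∨ x = 0) → (x + 2 * k, y) ∈ Q → 0 ≤ k ∧ k ≤ i := by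
    intro x y k hx hq
    have hne : conf st (x + 2 * k, y) ≠ none := hs hq
    rw [conf_cell _ _ _ _ hx] at hne
    by_contra hk
    apply hne
    by_cases hk0 : k < 0
    · rw [hst, lin_neg hk0]; rfl
    · rw [hst, lin_gt (by omega)]; rfl
  set B := Q.image (fun p => (p.1 + 1) / 2) with hB
  have hBne : B.Nonempty := hQ.image _
  obtain ⟨p, hpQ, hpk⟩ := Finset.mem_image.1 (B.min'_mem hBne)
  set k := B.min' hBne with hk
  have hmin : ∀ q ∈ Q, k ≤ (q.1 + 1) / 2 := by
    intro q hq
    exact B.min'_le _ (Finset.mem_image.2 ⟨q, hq, rfl⟩)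
  obtain ⟨x, y, hx, rfl⟩ : ∃ x y : ℤ, (x = -1 ∨ x = 0) ∧ p = (x + 2 * k, y) :=
    ⟨p.1 - 2 * k, p.2, by omega, by ext <;> simp⟩
  have hk0 := hblk x y k hx hpQ
  have hfix : ∀ p ∈ fixd (decide (k = 0)), p ∉ win k Q := by
    rintro ⟨u, v⟩ hp hw
    rw [mem_win] at hw
    by_cases hk' : k = 0
    · simp [hk', fixd] at hp
      rw [hk', hp.1, hp.2] at hw
      exact h0 (by simpa using hw)
    · have hu : u = -2 := by
        simp only [hk', fixd, decide_false, Bool.false_eq_true, if_false, List.mem_cons,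
          Prod.mk.injEq, List.not_mem_nil, or_false] at hp
        omega
      have := hmin _ hw
      simp only at this
      omega
  have hpne : conf st (x + 2 * k, y) ≠ none := hs hpQ
  by_cases hki : k < i
  · exfalso
    have hn : leB (sG false) (st (k + 1)) = true := by
      by_cases h1 : k + 1 = i
      · rw [hst, lin_cur h1]; exact hX (by omega)
      · have : st (k + 1) = sD false (b (k + 1).toNat) := by
          have h3 : decide (k + 1 = 0) = false := by simp; omega
          by_cases h2 : k + 1 + 1 = i
          · rw [hst, lin_prev (by omega) h2, h3]
          · rw [hst, lin_far (by omega) (by omega), h3]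
        rw [this]
        exact sG_le_sD _
    have hcur : st k = sD (decide (k = 0)) (b k.toNat) := by
      by_cases h2 : k + 1 = i
      · rw [hst, lin_prev (by omega) h2]
      · rw [hst, lin_far (by omega) (by omega)]
    rcases cutB_sound (chkC_cut _ _) hcur (lin_prevs hk0.1 hki) (Or.inr hn)
      (lt_of_lt_of_le hcut hτ) hfix with hh | hh
    · exact hh x y hx hpne hpQ
    · have := (hh x y hx hpne).1 hpQ
      simp at this
  · have hki' : k = i := by omega
    have hd : decide (k = 0) = decide (i = 0) := by simp [hki']
    rw [hd] at hfix
    rcases cutB_sound h (lin_cur hki') (by rw [hki']; exact lin_prevs_cur) (Or.inl rfl)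
      hcut hfix with hh | hh
    · exact absurd hpQ (hh x y hx hpne)
    · ext q
      rw [Finset.mem_image]
      constructor
      · intro hq
        obtain ⟨k', u, v, hu, rfl⟩ := exists_loc q
        have h1 := hblk u v k' hu hq
        have h2 := hmin _ hq
        simp only at h2
        have hkk : k' = k := by omega
        subst hkk
        refine ⟨(u, v), List.mem_toFinset.2 ((hh u v hu (hs hq)).1 hq), ?_⟩
        simp [sft, hki']
      · rintro ⟨⟨u, v⟩, hq, rfl⟩
        rw [List.mem_toFinset] at hq
        have hu : u = -1 ∨ u = 0 := by
          have : ∀ p ∈ cells, p.1 = -1 ∨ p.1 = 0 := by decide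
          exact this _ (hQ0 _ hq).1
        have := (hh u v hu (by
          rw [conf_cell _ _ _ _ hu, lin_cur hki']
          exact Option.isSome_iff_ne_none.1 (hQ0 _ hq).2)).2 hq
        simpa [sft, hki'] using this


theorem cut_congr {C D : Config} {Q : Finset (ℤ × ℤ)}
    (h : ∀ p ∈ Q, C p = D p ∧ ∀ q ∈ neighbors p, C q = D q) :
    cutStrength G C Q = cutStrength G D Q := by
  unfold cutStrength
  apply Finset.sum_congr rfl
  intro p hp
  rw [out_eq_sum, out_eq_sum]
  apply Finset.sum_congr rfl
  intro q hq
  have hq' := List.mem_toFinset.1 (Finset.mem_filter.1 hq).1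
  unfold bondAt
  rw [(h p hp).1, (h p hp).2 q hq']

theorem cells_fst {p : ℤ × ℤ} (h : p ∈ cells) : p.1 = -1 ∨ p.1 = 0 := by
  have : ∀ p ∈ cells, p.1 = -1 ∨ p.1 = 0 := by decide
  exact this p h

theorem stable_cut {τ i : ℕ} {b : ℕ → Bool} {X : St} (hτ : τ ≤ 9)
    (h : cutB τ (decide (i = 0)) X sE [] = true)
    (hX : i ≠ 0 → leB (sG false) X = true) : Stable G τ (conf (lin i b sD X)) := by
  intro Q hQ h0 hs
  by_contra hc
  have := low_cut hτ h hX (by simp) hQ h0 hs (by omega)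
  simp at this
  exact hQ.ne_empty this

theorem rem_step {τ i : ℕ} {b : ℕ → Bool} {X X0 : St} {Q0 : List (ℤ × ℤ)} (hτ : τ ∈ ct)
    (hτ9 : τ ≤ 9) (hid : idB τ (decide (i = 0)) X = true)
    (h : cutB τ (decide (i = 0)) X sE Q0 = true)
    (hX : i ≠ 0 → leB (sG false) X = true)
    (hr : remB τ (decide (i = 0)) X X0 Q0 = true) (E : Config) :
    Step T G τ (conf (lin i b sD X)) E ↔ E = conf (lin i b sD X0) := by
  unfold remB at hr
  simp only [Bool.and_eq_true] at hr
  obtain ⟨⟨⟨hdiff, hocc⟩, hcut⟩, hne⟩ := hr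
  have hne := of_decide_eq_true hne
  have hQ0 : ∀ p ∈ Q0, p ∈ cells ∧ (cell X (p.1 + 1) (p.2 + 6)).isSome = true := by
    intro p hp
    have := List.all_eq_true.1 hocc p hp
    rw [Bool.and_eq_true] at this
    exact ⟨of_decide_eq_true this.1, this.2⟩
  set Q := Q0.toFinset.image (sft i) with hQ
  have hmem : ∀ x y k : ℤ, (x = -1 ∨ x = 0) →
      ((x + 2 * k, y) ∈ Q ↔ k = i ∧ (x, y) ∈ Q0) := by
    intro x y k hx
    rw [hQ, Finset.mem_image]
    constructor
    · rintro ⟨⟨u, v⟩, hq, he⟩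
      rw [List.mem_toFinset] at hq
      have := cells_fst (hQ0 _ hq).1
      simp only [sft, Prod.mk.injEq] at he this
      have hk : k = i := by omega
      have hu : u = x := by omega
      rw [hu, he.2] at hq
      exact ⟨hk, hq⟩
    · rintro ⟨rfl, hq⟩
      exact ⟨(x, y), List.mem_toFinset.2 hq, rfl⟩
  have hres : (fun q => if q ∈ Q then none else conf (lin i b sD X) q) =
      conf (lin i b sD X0) := by
    funext q
    obtain ⟨k, x, y, hx, rfl⟩ := exists_loc q
    rw [conf_cell _ _ _ _ hx, conf_cell _ _ _ _ hx]
    by_cases hk : k = i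
    · rw [lin_cur hk, lin_cur hk]
      by_cases hy : y < -6 ∨ 5 ≤ y
      · rw [cell_out _ _ _ (by omega), cell_out _ _ _ (by omega)]
        simp
      · have := of_decide_eq_true
          (List.all_eq_true.1 hdiff (x, y) (mem_cells hx (by omega) (by omega)))
        rw [← this]
        have e := hmem x y k hx
        simp only [hk, true_and] at e ⊢
        simp only [e]
    · have e : lin i b sD X k = lin i b sD X0 k := by
        unfold lin; split_ifs <;> rfl
      rw [e, if_neg]
      rw [hmem x y k hx]
      exact fun h => hk h.1
  constructor
  · intro hst
    cases hst with
    | attach t p ht hp ha =>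
      exfalso
      unfold idB phaseB at hid
      simp only [Bool.and_eq_true] at hid
      have := stgs_sound (b := b) hτ [] [] _ hid.1.2 t ht p hp ha
      rcases this with h' | h'
      · simp at h'
      · change conf (lin i b sD X) p = some t at h'
        rw [hp] at h'
        cases h'
    | detach Q' hQ' h0 hs hc =>
      have := low_cut hτ9 h hX hQ0 hQ' h0 hs hc
      rw [this]
      exact hres
  · rintro rfl
    rw [← hres]
    refine Step.detach _ Q ?_ ?_ ?_ ?_
    · rw [hQ, Finset.image_nonempty]
      rw [List.toFinset_nonempty_iff]
      exact hne.2
    · intro h0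
      have := (hmem 0 0 0 (Or.inr rfl)).1 (by simpa using h0)
      exact hne.1 this.2
    · intro q hq
      obtain ⟨k, x, y, hx, rfl⟩ := exists_loc q
      have := (hmem x y k hx).1 hq
      change conf (lin i b sD X) (x + 2 * k, y) ≠ none
      rw [conf_cell _ _ _ _ hx, lin_cur this.1]
      exact Option.isSome_iff_ne_none.1 (hQ0 _ this.2).2
    · have hc := of_decide_eq_true (List.all_eq_true.1 hcut _ (lin_prevs_cur (b := b) (X := X)))
      rw [← cut_win _ i]
      have hw : win i Q = Q0.toFinset := by
        ext ⟨u, v⟩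
        rw [mem_win, List.mem_toFinset]
        constructor
        · intro hq
          rw [hQ, Finset.mem_image] at hq
          obtain ⟨⟨x, y⟩, hq, he⟩ := hq
          simp only [sft, Prod.mk.injEq, add_left_inj] at he
          rw [← he.1, ← he.2]
          exact List.mem_toFinset.1 hq
        · intro hq
          exact (hmem u v i (cells_fst (hQ0 _ hq).1)).2 ⟨rfl, hq⟩
      rw [hw]
      refine lt_of_eq_of_lt ?_ hc
      have hl : ∀ x y : ℤ, -3 ≤ x → x ≤ 2 → sh (conf (lin i b sD X)) i (x, y) =
          conf (tri (lin i b sD X ((i : ℤ) - 1)) X sE) (x, y) := by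
        intro x y h1 h2
        have := conf_loc (lin i b sD X) i x y h1 h2
        rw [lin_cur (k := (i : ℤ)) rfl, lin_gt (k := (i : ℤ) + 1) (by omega)] at this
        exact this
      apply cut_congr
      rintro ⟨x, y⟩ hp
      have hx := cells_fst (hQ0 _ (List.mem_toFinset.1 hp)).1
      simp only at hx
      refine ⟨hl x y (by omega) (by omega), ?_⟩
      intro q hq
      simp only [neighbors, List.mem_cons, List.not_mem_nil, or_false] at hq
      rcases hq with rfl | rfl | rfl | rfl <;> exact hl _ _ (by omega) (by omega)

theorem le_sP : leB (sG false) (sP false) = true := by decide +kernel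
theorem le_sG : leB (sG false) (sG false) = true := by decide +kernel
theorem le_sR (b : Bool) : leB (sG false) (sR false b) = true := by cases b <;> decide +kernel
theorem le_sS (b : Bool) : leB (sG false) (sS false b) = true := by cases b <;> decide +kernel

theorem dec_false {i : ℕ} (h : i ≠ 0) : decide (i = 0) = false := by simp [h]

theorem lin_succ (i : ℕ) (b : ℕ → Bool) :
    lin (i + 1) b sS sE = lin i b sD (sS (decide (i = 0)) (b i)) := by
  funext k
  by_cases h1 : k < 0
  · rw [lin_neg h1, lin_neg h1]
  by_cases h2 : k + 1 < i
  · rw [lin_far (by omega) (by push_cast; omega), lin_far (by omega) h2]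
  by_cases h3 : k + 1 = i
  · rw [lin_far (by omega) (by push_cast; omega), lin_prev (by omega) h3]
  by_cases h4 : k = i
  · rw [lin_prev (by omega) (by push_cast; omega), lin_cur h4, h4]
    simp
  rw [lin_gt (i := i) (by omega)]
  by_cases h5 : k = i + 1
  · rw [lin_cur (by push_cast; omega)]
  · rw [lin_gt (by push_cast; omega)]

/-- final configuration after the third phase of block `i` -/
def fin3 (b : ℕ → Bool) (i : ℕ) : Config := conf (lin i b sD (sR (decide (i = 0)) (b i)))
def st0 (b : ℕ → Bool) (i : ℕ) : Config := conf (lin i b sS (gd1 (decide (i = 0))))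

theorem blk3 (b : ℕ → Bool) (i : ℕ) (hS : Stable G 4 (st0 b i)) :
    Chain (Step T G) [4, if b i then 9 else 4, 3] (st0 b i) (fin3 b i) ∧
      Stable G 3 (fin3 b i) := by
  have p1 : PhaseTo (Step T G 4) (st0 b i) (conf (lin i b sD (sP (decide (i = 0))))) ∧
      Stable G 4 (conf (lin i b sD (sP (decide (i = 0))))) := by
    have := phase (τ := 4) (by decide) (bs_all chk1_eq (decide (i = 0))) hS
    have e : cfg i b (lastS (s1 (decide (i = 0))) (r1 (decide (i = 0)))) =
        conf (lin i b sD (sP (decide (i = 0)))) := by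
      by_cases hi : i = 0
      · simp only [hi, decide_true]; rfl
      · simp only [hi, decide_false]; rfl
    rw [e] at this
    exact this
  have p2 : PhaseTo (Step T G (if b i then 9 else 4)) (conf (lin i b sD (sP (decide (i = 0)))))
      (conf (lin i b sD (sQ (decide (i = 0)) (b i)))) ∧
      Stable G 3 (conf (lin i b sD (sQ (decide (i = 0)) (b i)))) := by
    cases hb : b i with
    | false => exact ⟨phaseTo_terminal p1.1.2.2.1, p1.2.mono (by omega)⟩
    | true =>
      have c2 := (Bool.and_eq_true _ _).mp (bs_all chk2_eq (decide (i = 0)))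
      have cC := (Bool.and_eq_true _ _).mp (bs_all chkC2_eq (decide (i = 0)))
      have cR := (Bool.and_eq_true _ _).mp (bs_all chkR_eq (decide (i = 0)))
      have hs : Stable G 9 (conf (lin i b sD (sG (decide (i = 0))))) :=
        stable_cut le_rfl cC.2 (fun h => by rw [dec_false h]; exact le_sG)
      have hph := phase (τ := 9) (by decide) c2.2 hs
      refine ⟨phaseTo_head (rem_step (by decide) le_rfl c2.1 cC.1
        (fun h => by rw [dec_false h]; exact le_sP) cR.1) hph.1, hph.2.mono (by omega)⟩
  have p3 := phase (τ := 3) (by decide) (bs_all (bs_all chk3_eq (decide (i = 0))) (b i)) p2.2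
  exact ⟨.cons p1.1 (.cons p2.1 (.cons p3.1 .nil)), p3.2⟩

theorem blk4 (b : ℕ → Bool) (i : ℕ) :
    PhaseTo (Step T G 7) (fin3 b i) (st0 b (i + 1)) ∧ Stable G 4 (st0 b (i + 1)) := by
  have e : st0 b (i + 1) = conf (lin i b sD (sS (decide (i = 0)) (b i))) := by
    unfold st0
    rw [← lin_succ]
    simp [gd1]
  rw [e]
  have c4 := (Bool.and_eq_true _ _).mp (bs_all (bs_all chk4_eq (decide (i = 0))) (b i))
  have cC := (Bool.and_eq_true _ _).mp (bs_all (bs_all chkC4_eq (decide (i = 0))) (b i))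
  have cR := bs_all ((Bool.and_eq_true _ _).mp (bs_all chkR_eq (decide (i = 0)))).2 (b i)
  have hs : Stable G 7 (conf (lin i b sD (sS (decide (i = 0)) (b i)))) :=
    stable_cut (by omega) cC.2 (fun h => by rw [dec_false h]; exact le_sS _)
  have hph := phase (τ := 7) (by decide) c4.2 hs
  exact ⟨phaseTo_head (rem_step (by decide) (by omega) c4.1 cC.1
    (fun h => by rw [dec_false h]; exact le_sR _) cR) hph.1, hph.2.mono (by omega)⟩

theorem sI_cells : ∀ p ∈ cells, cell sI (p.1 + 1) (p.2 + 6) =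
    if p = (0, 0) then some q_seed else none := by decide +kernel

theorem seed_eq (b : ℕ → Bool) : seedConfig q_seed = st0 b 0 := by
  funext p
  obtain ⟨k, x, y, hx, rfl⟩ := exists_loc p
  unfold st0
  rw [conf_cell _ _ _ _ hx]
  unfold seedConfig
  by_cases hk : k = 0
  · subst hk
    rw [lin_cur (by simp)]
    by_cases hy : y < -6 ∨ 5 ≤ y
    · rw [cell_out _ _ _ (by omega), if_neg]
      simp only [Prod.mk.injEq]; omega
    · have := sI_cells (x, y) (mem_cells hx (by omega) (by omega))
      simp only [mul_zero, add_zero]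
      exact this.symm
  · rw [if_neg (by simp only [Prod.mk.injEq]; omega)]
    rcases lt_or_gt_of_ne hk with h | h
    · rw [lin_neg h]; rfl
    · rw [lin_gt (by simpa using h)]; rfl

theorem seed_stable (b : ℕ → Bool) : Stable G 4 (st0 b 0) := by
  rw [← seed_eq]
  intro Q hQ h0 hs
  exfalso
  obtain ⟨q, hq⟩ := hQ
  have : seedConfig q_seed q ≠ none := hs hq
  apply this
  unfold seedConfig
  rw [if_neg]
  rintro rfl
  exact h0 hq

def tmp (b : ℕ → Bool) (j : ℕ) : ℕ :=
    if j % 4 = 0 then 4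
    else if j % 4 = 1 then (if b (j / 4) then 9 else 4)
    else if j % 4 = 2 then 3
    else 7

theorem tmp_0 (b : ℕ → Bool) (i : ℕ) : tmp b (4 * i) = 4 := by
  unfold tmp; rw [if_pos (by omega)]
theorem tmp_1 (b : ℕ → Bool) (i : ℕ) : tmp b (4 * i + 1) = if b i then 9 else 4 := by
  unfold tmp; rw [if_neg (by omega), if_pos (by omega), show (4 * i + 1) / 4 = i by omega]
theorem tmp_2 (b : ℕ → Bool) (i : ℕ) : tmp b (4 * i + 2) = 3 := by
  unfold tmp; rw [if_neg (by omega), if_neg (by omega), if_pos (by omega)]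
theorem tmp_3 (b : ℕ → Bool) (i : ℕ) : tmp b (4 * i + 3) = 7 := by
  unfold tmp; rw [if_neg (by omega), if_neg (by omega), if_neg (by omega)]

theorem range3 (b : ℕ → Bool) (i : ℕ) : (List.range (4 * i + 3)).map (tmp b) =
    (List.range (4 * i)).map (tmp b) ++ [4, if b i then 9 else 4, 3] := by
  rw [List.range_succ, List.range_succ, List.range_succ]
  simp only [List.map_append, List.map_cons, List.map_nil, tmp_0, tmp_1, tmp_2,
    List.append_assoc, List.cons_append, List.nil_append]

theorem range4 (b : ℕ → Bool) (i : ℕ) : (List.range (4 * (i + 1))).map (tmp b) =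
    (List.range (4 * i + 3)).map (tmp b) ++ [7] := by
  rw [show 4 * (i + 1) = 4 * i + 3 + 1 by ring, List.range_succ]
  simp only [List.map_append, List.map_cons, List.map_nil, tmp_3]

theorem chain4 (b : ℕ → Bool) : ∀ i : ℕ,
    Chain (Step T G) ((List.range (4 * i)).map (tmp b)) (seedConfig q_seed) (st0 b i) ∧
      Stable G 4 (st0 b i)
  | 0 => ⟨by rw [← seed_eq]; exact .nil, seed_stable b⟩
  | i + 1 => by
      obtain ⟨h1, h2⟩ := chain4 b i
      have h3 := blk3 b i h2
      have h4 := blk4 b i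
      refine ⟨?_, h4.2⟩
      rw [range4, range3]
      exact (h1.append h3.1).append (.cons h4.1 .nil)

theorem chain_fin (b : ℕ → Bool) (i : ℕ) :
    Chain (Step T G) (tempSeq1 b (i + 1)) (seedConfig q_seed) (fin3 b i) := by
  obtain ⟨h1, h2⟩ := chain4 b i
  have h3 := blk3 b i h2
  have e : tempSeq1 b (i + 1) = (List.range (4 * i + 3)).map (tmp b) := rfl
  rw [e, range3]
  exact h1.append h3.1

theorem full_D : ∀ f b : Bool, ∀ p ∈ cells, -6 ≤ p.2 → p.2 < 5 →
    (cell (sD f b) (p.1 + 1) (p.2 + 6)).isSome = true := by decide +kernel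
theorem full_R : ∀ f b : Bool, ∀ p ∈ cells, -6 ≤ p.2 → p.2 < 5 →
    (cell (sR f b) (p.1 + 1) (p.2 + 6)).isSome = true := by decide +kernel
theorem top_D : ∀ f b : Bool, cell (sD f b) 0 10 = some (if b then q_t1 else q_t0) := by
  decide +kernel
theorem top_R : ∀ f b : Bool, cell (sR f b) 0 10 = some (if b then q_t1 else q_t0) := by
  decide +kernel

theorem fin_state (b : ℕ → Bool) (n : ℕ) {k : ℤ} (h0 : 0 ≤ k) (h1 : k ≤ n) :
    ∃ f, lin n b sD (sR (decide (n = 0)) (b n)) k = sD f (b k.toNat) ∨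
      lin n b sD (sR (decide (n = 0)) (b n)) k = sR f (b k.toNat) := by
  by_cases h2 : k + 1 < n
  · exact ⟨_, Or.inl (lin_far h0 h2)⟩
  by_cases h3 : k + 1 = n
  · exact ⟨_, Or.inl (lin_prev h0 h3)⟩
  have h4 : k = n := by omega
  refine ⟨decide (n = 0), Or.inr ?_⟩
  rw [lin_cur h4, h4]; simp

theorem fin_shape (b : ℕ → Bool) (n : ℕ) :
    shape (fin3 b n) = translateSet (-1, -6) (rect 11 (2 * (n + 1))) := by
  ext ⟨x', y⟩
  have hR : (x', y) ∈ translateSet (-1, -6) (rect 11 (2 * (n + 1))) ↔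
      (-1 ≤ x' ∧ x' ≤ 2 * n ∧ -6 ≤ y ∧ y < 5) := by
    unfold translateSet rect
    constructor
    · rintro ⟨⟨u, v⟩, h, e⟩
      simp only [Prod.mk_add_mk, Prod.mk.injEq, Set.mem_ofPred_eq] at h e
      push_cast at h
      omega
    · intro h
      refine ⟨(x' + 1, y + 6), ?_, by simp⟩
      simp only [Set.mem_ofPred_eq]
      push_cast
      omega
  rw [hR]
  change fin3 b n (x', y) ≠ none ↔ _
  obtain ⟨k, x, y', hx, he⟩ := exists_loc (x', y)
  simp only [Prod.mk.injEq] at he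
  obtain ⟨rfl, rfl⟩ := he
  unfold fin3
  rw [conf_cell _ _ _ _ hx]
  constructor
  · intro h
    have hy : -6 ≤ y ∧ y < 5 := by
      by_contra hy
      exact h (cell_out _ _ _ (by omega))
    have hk : 0 ≤ k := by
      by_contra hk
      rw [lin_neg (by omega)] at h
      exact h rfl
    have hk' : k ≤ n := by
      by_contra hk
      rw [lin_gt (by omega)] at h
      exact h rfl
    omega
  · rintro ⟨h1, h2, h3, h4⟩
    have hc := mem_cells (y := y) hx (by omega) (by omega)
    obtain ⟨f, h | h⟩ := fin_state b n (k := k) (by omega) (by omega)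
    · rw [h]; exact Option.isSome_iff_ne_none.1 (full_D _ _ _ hc h3 h4)
    · rw [h]; exact Option.isSome_iff_ne_none.1 (full_R _ _ _ hc h3 h4)

theorem fin_top (b : ℕ → Bool) (n i : ℕ) (hi : i < n + 1) :
    fin3 b n (-1 + 2 * (i : ℤ), -6 + 10) = some (if b i then q_t1 else q_t0) := by
  unfold fin3
  rw [conf_cell _ _ _ _ (Or.inl rfl)]
  obtain ⟨f, h | h⟩ := fin_state b n (k := (i : ℤ)) (by omega) (by omega)
  · rw [h, Int.toNat_natCast]; exact top_D _ _
  · rw [h, Int.toNat_natCast]; exact top_R _ _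

theorem mem_T : q_seed ∈ T ∧ q_t0 ∈ T ∧ q_t1 ∈ T := by decide +kernel

end MT

/-- There are a fixed finite tile set `T` (independent of `m`), seed `s ∈ T`,
glue function `G` with strengths at most 9, and distinguished tiles `t₀, t₁ ∈ T`, such that
for every `m ≥ 1` and every binary string `b`, under the temperature sequence `τ^b` the
system uniquely assembles an `11 × 2m` rectangle whose top-row tile at horizontal position
`2i + 1` (counting from 1 at the west end) is `t₀` if `b i = 0` and `t₁` if `b i = 1`. -/
theorem stmt1 :
    ∃ (T : Finset Tile) (s : Tile) (G : Glue → ℕ) (t₀ t₁ : Tile),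
      s ∈ T ∧ t₀ ∈ T ∧ t₁ ∈ T ∧ G 0 = 0 ∧ (∀ x, G x ≤ 9) ∧
      ∀ m : ℕ, 1 ≤ m → ∀ b : ℕ → Bool,
        ∃ (S : Config) (d : ℤ × ℤ),
          UniquelyProduces (Step T G) s (tempSeq1 b m) S ∧
          shape S = translateSet d (rect 11 (2 * m)) ∧
          ∀ i : ℕ, i < m →
            S (d.1 + 2 * (i : ℤ), d.2 + 10) = some (if b i then t₁ else t₀) := by
  refine ⟨MT.T, MT.q_seed, MT.G, MT.q_t0, MT.q_t1, MT.mem_T.1, MT.mem_T.2.1, MT.mem_T.2.2,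
    MT.G_zero, MT.G_le, ?_⟩
  intro m hm b
  obtain ⟨n, rfl⟩ : ∃ n, m = n + 1 := ⟨m - 1, by omega⟩
  exact ⟨MT.fin3 b n, (-1, -6), (MT.chain_fin b n).result, MT.fin_shape b n,
    fun i hi => MT.fin_top b n i hi⟩
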